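/- Let N be a positive integer, 0 < s < 1 with N > 2s, α > -2s and p > 1. There exists a constant c = c(N,s) > 0 such that every nonnegative function u ∈ L_{2s} that is locally bounded on ℝ^N and is a distributional solution of (-Δ)^s u = |x|^α u^p satisfies u(x) = c ∫_{ℝ^N} |y|^α u(y)^p |x-y|^{-(N-2s)} dy for almost every x ∈ ℝ^N; in particular the integral on the right-hand side is finite for almost every x. -/

import Mathlib

open MeasureTheory Filter Set

namespace FractionalLaplacian

/-- Euclidean space of dimension `N`. -/
abbrev Euc (N : ℕ) := EuclideanSpace ℝ (Fin N)

/-- The heat kernel on `ℝ^N`. -/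
noncomputable def heat {N : ℕ} (t : ℝ) (z : Euc N) : ℝ :=
  (4 * Real.pi * t) ^ (-(N : ℝ) / 2) * Real.exp (-‖z‖ ^ 2 / (4 * t))

section Heat

variable {N : ℕ}

lemma heat_pos {t : ℝ} (ht : 0 < t) (z : Euc N) : 0 < heat t z := by
  unfold heat; positivity

lemma heat_nonneg {t : ℝ} (ht : 0 < t) (z : Euc N) : 0 ≤ heat t z := (heat_pos ht z).le

lemma heat_neg (t : ℝ) (z : Euc N) : heat t (-z) = heat t z := by simp [heat]

lemma heat_sub_comm (t : ℝ) (x y : Euc N) : heat t (x - y) = heat t (y - x) := by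
  rw [← heat_neg, neg_sub]

lemma measurable_heat : Measurable (fun p : ℝ × Euc N => heat p.1 p.2) := by
  unfold heat; fun_prop

lemma continuous_heat (t : ℝ) : Continuous (fun z : Euc N => heat t z) := by
  unfold heat; fun_prop

lemma integral_heat {t : ℝ} (ht : 0 < t) : ∫ z : Euc N, heat t z = 1 := by
  unfold heat
  rw [integral_const_mul]
  have := GaussianFourier.integral_rexp_neg_mul_sq_norm (V := Euc N) (b := 1 / (4 * t))
    (by positivity)
  have h2 : ∀ v : Euc N, -‖v‖ ^ 2 / (4 * t) = -(1 / (4 * t)) * ‖v‖ ^ 2 := fun v => by ring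
  simp_rw [h2, this]
  rw [finrank_euclideanSpace_fin, show Real.pi / (1 / (4 * t)) = 4 * Real.pi * t by field_simp,
    ← Real.rpow_add (by positivity)]
  simp [neg_div]

lemma integrable_heat {t : ℝ} (ht : 0 < t) : Integrable (fun z : Euc N => heat t z) := by
  by_contra h
  have := integral_undef h
  rw [integral_heat ht] at this
  exact one_ne_zero this

lemma heat_convolution {a b : ℝ} (ha : 0 < a) (hb : 0 < b) (x : Euc N) :
    ∫ y : Euc N, heat a (x - y) * heat b y = heat (a + b) x := by
  have key : ∀ y : Euc N, heat a (x - y) * heat b y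
      = heat (a + b) x * heat (a * b / (a + b)) (y - (b / (a + b)) • x) := by
    intro y
    unfold heat
    have e1 : (4 * Real.pi * a) ^ (-(N : ℝ) / 2) * (4 * Real.pi * b) ^ (-(N : ℝ) / 2)
        = (4 * Real.pi * (a + b)) ^ (-(N : ℝ) / 2)
          * (4 * Real.pi * (a * b / (a + b))) ^ (-(N : ℝ) / 2) := by
      rw [← Real.mul_rpow (by positivity) (by positivity),
        ← Real.mul_rpow (by positivity) (by positivity)]
      congr 1
      field_simp
    have e2 : -‖x - y‖ ^ 2 / (4 * a) + -‖y‖ ^ 2 / (4 * b)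
        = -‖x‖ ^ 2 / (4 * (a + b))
          + -‖y - (b / (a + b)) • x‖ ^ 2 / (4 * (a * b / (a + b))) := by
      rw [norm_sub_sq_real, norm_sub_sq_real, norm_smul, real_inner_smul_right,
        Real.norm_of_nonneg (by positivity), real_inner_comm]
      field_simp
      ring
    calc _ = ((4 * Real.pi * a) ^ (-(N : ℝ) / 2) * (4 * Real.pi * b) ^ (-(N : ℝ) / 2))
          * (Real.exp (-‖x - y‖ ^ 2 / (4 * a)) * Real.exp (-‖y‖ ^ 2 / (4 * b))) := by ring
      _ = _ := by rw [e1, ← Real.exp_add, e2, Real.exp_add]; ring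
  simp_rw [key]
  rw [integral_const_mul, integral_sub_right_eq_self (fun y : Euc N => heat (a * b / (a + b)) y),
    integral_heat (by positivity), mul_one]

lemma integrable_heat_mul_heat {a b : ℝ} (ha : 0 < a) (hb : 0 < b) (x : Euc N) :
    Integrable (fun y : Euc N => heat a (x - y) * heat b y) := by
  by_contra h
  have := integral_undef h
  rw [heat_convolution ha hb] at this
  exact (heat_pos (by positivity) x).ne' this

lemma heat_le_of_comparison {a b : ℝ} (ha : 0 < a) (hb : 0 < b) {z w : Euc N} {K : ℝ}
    (h : -‖z‖ ^ 2 / (4 * a) ≤ -‖w‖ ^ 2 / (4 * b) + K) :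
    heat a z ≤ (b / a) ^ ((N : ℝ) / 2) * Real.exp K * heat b w := by
  unfold heat
  have e1 : (b / a) ^ ((N : ℝ) / 2) * (4 * Real.pi * b) ^ (-(N : ℝ) / 2)
      = (4 * Real.pi * a) ^ (-(N : ℝ) / 2) := by
    rw [show 4 * Real.pi * b = (b / a) * (4 * Real.pi * a) by field_simp,
      Real.mul_rpow (by positivity) (by positivity), ← mul_assoc,
      ← Real.rpow_add (by positivity)]
    simp [neg_div]
  calc _ ≤ (4 * Real.pi * a) ^ (-(N : ℝ) / 2) * Real.exp (-‖w‖ ^ 2 / (4 * b) + K) := by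
        gcongr
    _ = _ := by rw [← e1, Real.exp_add]; ring

lemma heat_le_heat {a b : ℝ} (ha : 0 < a) (hab : a ≤ b) (z : Euc N) :
    heat a z ≤ (b / a) ^ ((N : ℝ) / 2) * heat b z := by
  have h : -‖z‖ ^ 2 / (4 * a) ≤ -‖z‖ ^ 2 / (4 * b) + 0 := by
    rw [neg_div, neg_div, add_zero, neg_le_neg_iff]
    gcongr
  simpa using heat_le_of_comparison ha (ha.trans_le hab) h

lemma heat_le_heat_of_ratio {a b K : ℝ} (ha : 0 < a) (hab : a ≤ b) (hK : b ≤ K * a) (z : Euc N) :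
    heat a z ≤ K ^ ((N : ℝ) / 2) * heat b z := by
  have hb := ha.trans_le hab
  refine (heat_le_heat ha hab z).trans ?_
  have := heat_nonneg hb z
  have : b / a ≤ K := by rwa [div_le_iff₀ ha]
  gcongr

/-- Parabolic Harnack inequality for translated heat kernels. -/
lemma heat_harnack {a b : ℝ} (ha : 0 < a) (hab : 3 / 2 * a ≤ b) (hba : b ≤ 3 * a)
    {x x' : Euc N} (hx : ‖x - x'‖ ^ 2 ≤ a) (y : Euc N) :
    heat a (x - y) ≤ (3 : ℝ) ^ ((N : ℝ) / 2) * Real.exp (1 / 2) * heat b (x' - y) := by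
  have hb : 0 < b := by linarith
  have h : -‖x - y‖ ^ 2 / (4 * a) ≤ -‖x' - y‖ ^ 2 / (4 * b) + 1 / 2 := by
    have h1 : ‖x' - y‖ ^ 2 ≤ 3 / 2 * ‖x - y‖ ^ 2 + 3 * ‖x - x'‖ ^ 2 := by
      have h2 : ‖x' - y‖ ≤ ‖x - x'‖ + ‖x - y‖ := by
        have : x' - y = (x - y) - (x - x') := by abel
        rw [this]; linarith [norm_sub_le (x - y) (x - x')]
      nlinarith [sq_nonneg (‖x - y‖ - 2 * ‖x - x'‖), norm_nonneg (x' - y), norm_nonneg (x - y),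
        norm_nonneg (x - x')]
    have h3 : ‖x' - y‖ ^ 2 / (4 * b) ≤ ‖x' - y‖ ^ 2 / (6 * a) := by
      exact div_le_div_of_nonneg_left (sq_nonneg _) (by positivity) (by linarith)
    have h4 : ‖x' - y‖ ^ 2 / (6 * a) ≤ (3 / 2 * ‖x - y‖ ^ 2 + 3 * a) / (6 * a) := by
      gcongr; linarith
    have h5 : (3 / 2 * ‖x - y‖ ^ 2 + 3 * a) / (6 * a) = ‖x - y‖ ^ 2 / (4 * a) + 1 / 2 := by
      field_simp; ring
    rw [neg_div, neg_div]
    linarith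
  refine (heat_le_of_comparison ha hb h).trans ?_
  have := heat_nonneg hb (x' - y)
  have : b / a ≤ 3 := by rwa [div_le_iff₀ ha]
  gcongr

lemma heat_le_rpow {t : ℝ} (ht : 0 < t) (z : Euc N) :
    heat t z ≤ (4 * Real.pi * t) ^ (-(N : ℝ) / 2) := by
  unfold heat
  have : Real.exp (-‖z‖ ^ 2 / (4 * t)) ≤ 1 := by
    rw [Real.exp_le_one_iff, neg_div]
    exact neg_nonpos.2 (by positivity)
  exact mul_le_of_le_one_right (by positivity) this

/-- The time derivative of the heat kernel. -/
noncomputable def heatDeriv (t : ℝ) (z : Euc N) : ℝ :=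
  heat t z * (‖z‖ ^ 2 / (4 * t ^ 2) - N / (2 * t))

lemma measurable_heatDeriv : Measurable (fun p : ℝ × Euc N => heatDeriv p.1 p.2) := by
  unfold heatDeriv
  have := measurable_heat (N := N)
  fun_prop

lemma hasDerivAt_heat {t : ℝ} (ht : 0 < t) (z : Euc N) :
    HasDerivAt (fun t => heat t z) (heatDeriv t z) t := by
  unfold heat heatDeriv heat
  have h1 : HasDerivAt (fun t : ℝ => (4 * Real.pi * t) ^ (-(N : ℝ) / 2))
      (4 * Real.pi * (-(N : ℝ) / 2) * (4 * Real.pi * t) ^ (-(N : ℝ) / 2 - 1)) t := by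
    have := ((hasDerivAt_id t).const_mul (4 * Real.pi)).rpow_const (p := -(N : ℝ) / 2)
      (Or.inl (by simp only [id]; positivity))
    simpa using this
  have h2 : HasDerivAt (fun t : ℝ => Real.exp (-‖z‖ ^ 2 / (4 * t)))
      (Real.exp (-‖z‖ ^ 2 / (4 * t)) * (‖z‖ ^ 2 / (4 * t ^ 2))) t := by
    have h3 : HasDerivAt (fun t : ℝ => -‖z‖ ^ 2 / (4 * t)) (‖z‖ ^ 2 / (4 * t ^ 2)) t := by
      have := (((hasDerivAt_id t).const_mul 4).fun_inv (by simp only [id]; positivity)).const_mul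
        (-‖z‖ ^ 2)
      refine this.congr_deriv ?_
      simp only [id]
      field_simp
    exact h3.exp
  refine (h1.mul h2).congr_deriv ?_
  rw [Real.rpow_sub_one (by positivity)]
  field_simp
  ring

lemma abs_heatDeriv_le {t : ℝ} (ht : 0 < t) (z : Euc N) :
    |heatDeriv t z| ≤ (2 + N / 2) * (2 : ℝ) ^ ((N : ℝ) / 2) * (t⁻¹ * heat (2 * t) z) := by
  have h0 := heat_nonneg (show 0 < 2 * t by positivity) z
  have h1 : heat t z * (‖z‖ ^ 2 / (4 * t)) ≤ 2 * (2 : ℝ) ^ ((N : ℝ) / 2) * heat (2 * t) z := by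
    unfold heat
    have e1 : (2 : ℝ) ^ ((N : ℝ) / 2) * (4 * Real.pi * (2 * t)) ^ (-(N : ℝ) / 2)
        = (4 * Real.pi * t) ^ (-(N : ℝ) / 2) := by
      rw [show 4 * Real.pi * (2 * t) = 2 * (4 * Real.pi * t) by ring,
        Real.mul_rpow (by positivity) (by positivity), ← mul_assoc,
        ← Real.rpow_add (by positivity)]
      simp [neg_div]
    set X := ‖z‖ ^ 2 / (4 * t) with hX
    have hX0 : 0 ≤ X := by positivity
    have e2 : -‖z‖ ^ 2 / (4 * t) = -(X / 2) + -(X / 2) := by rw [hX]; ring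
    have e3 : -‖z‖ ^ 2 / (4 * (2 * t)) = -(X / 2) := by rw [hX]; field_simp
    rw [e2, e3, Real.exp_add]
    have h2 : Real.exp (-(X / 2)) * X ≤ 2 := by
      have h4 : Real.exp (-(X / 2)) * Real.exp (X / 2) = 1 := by rw [← Real.exp_add]; simp
      have : X / 2 ≤ Real.exp (X / 2) := by linarith [Real.add_one_le_exp (X / 2)]
      nlinarith [Real.exp_pos (-(X / 2))]
    calc _ = (4 * Real.pi * t) ^ (-(N : ℝ) / 2) * Real.exp (-(X / 2))
          * (Real.exp (-(X / 2)) * X) := by ring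
      _ ≤ (4 * Real.pi * t) ^ (-(N : ℝ) / 2) * Real.exp (-(X / 2)) * 2 := by gcongr
      _ = _ := by rw [← e1]; ring
  have h2 : heat t z ≤ (2 : ℝ) ^ ((N : ℝ) / 2) * heat (2 * t) z :=
    heat_le_heat_of_ratio ht (by linarith) le_rfl z
  have h3 := heat_nonneg ht z
  have e : heatDeriv t z = t⁻¹ * (heat t z * (‖z‖ ^ 2 / (4 * t)) - N / 2 * heat t z) := by
    unfold heatDeriv; field_simp
  rw [e, abs_mul, abs_of_pos (by positivity)]
  have h4 : |heat t z * (‖z‖ ^ 2 / (4 * t)) - N / 2 * heat t z|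
      ≤ heat t z * (‖z‖ ^ 2 / (4 * t)) + N / 2 * heat t z := by
    have a1 : 0 ≤ heat t z * (‖z‖ ^ 2 / (4 * t)) := by positivity
    have a2 : 0 ≤ N / 2 * heat t z := by positivity
    rw [abs_le]; constructor <;> linarith
  calc _ ≤ t⁻¹ * (2 * (2 : ℝ) ^ ((N : ℝ) / 2) * heat (2 * t) z
        + N / 2 * ((2 : ℝ) ^ ((N : ℝ) / 2) * heat (2 * t) z)) := by
        gcongr
        exact h4.trans (by gcongr)
    _ = _ := by ring

end Heat

section Subordination

variable {N : ℕ}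

/-- The constant in `∫₀^∞ r^(a-1) heat r z dr = C ‖z‖^(2a-N)`. -/
noncomputable def subConst (N : ℕ) (a : ℝ) : ℝ :=
  (4 * Real.pi) ^ (-(N : ℝ) / 2) * 4 ^ ((N : ℝ) / 2 - a) * Real.Gamma ((N : ℝ) / 2 - a)

lemma subConst_pos {a : ℝ} (ha : a < (N : ℝ) / 2) : 0 < subConst N a := by
  unfold subConst
  have := Real.Gamma_pos_of_pos (sub_pos.2 ha)
  positivity

lemma integral_rpow_mul_heat {a : ℝ} (ha : a < (N : ℝ) / 2) {z : Euc N} (hz : z ≠ 0) :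
    ∫ r in Ioi (0 : ℝ), r ^ (a - 1) * heat r z = subConst N a * ‖z‖ ^ (2 * a - N) := by
  have hz' : 0 < ‖z‖ := norm_pos_iff.2 hz
  rw [← integral_comp_rpow_Ioi _ (show (-1 : ℝ) ≠ 0 by norm_num)]
  have e : ∀ x ∈ Ioi (0 : ℝ), (|(-1 : ℝ)| * x ^ ((-1 : ℝ) - 1)) •
      ((x ^ (-1 : ℝ)) ^ (a - 1) * heat (x ^ (-1 : ℝ)) z)
      = (4 * Real.pi) ^ (-(N : ℝ) / 2) *
        (x ^ (((N : ℝ) / 2 - a) - 1) * Real.exp (-(‖z‖ ^ 2 / 4 * x))) := by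
    intro x hx
    have hx : 0 < x := hx
    unfold heat
    rw [Real.mul_rpow (by positivity) (by positivity), ← Real.rpow_mul hx.le,
      ← Real.rpow_mul hx.le, Real.rpow_neg_one]
    have e1 : x ^ (((N : ℝ) / 2 - a) - 1)
        = x ^ ((-1 : ℝ) - 1) * (x ^ (-1 * (a - 1)) * x ^ (-1 * (-(N : ℝ) / 2))) := by
      rw [← Real.rpow_add hx, ← Real.rpow_add hx]; congr 1; ring
    have e2 : -‖z‖ ^ 2 / (4 * x⁻¹) = -(‖z‖ ^ 2 / 4 * x) := by field_simp
    rw [e1, e2]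
    simp
    ring
  rw [setIntegral_congr_fun measurableSet_Ioi e, integral_const_mul,
    Real.integral_rpow_mul_exp_neg_mul_Ioi (by linarith) (by positivity)]
  unfold subConst
  have e3 : (1 / (‖z‖ ^ 2 / 4)) ^ ((N : ℝ) / 2 - a)
      = 4 ^ ((N : ℝ) / 2 - a) * ‖z‖ ^ (2 * a - N) := by
    rw [show 1 / (‖z‖ ^ 2 / 4) = 4 * (‖z‖ ^ (-2 : ℝ)) by
      rw [Real.rpow_neg hz'.le]; norm_cast; field_simp,
      Real.mul_rpow (by positivity) (by positivity), ← Real.rpow_mul hz'.le]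
    congr 2; ring
  rw [e3]; ring

lemma integrableOn_rpow_mul_heat {a : ℝ} (ha : a < (N : ℝ) / 2) {z : Euc N} (hz : z ≠ 0) :
    IntegrableOn (fun r => r ^ (a - 1) * heat r z) (Ioi (0 : ℝ)) := by
  have hz' : 0 < ‖z‖ := norm_pos_iff.2 hz
  by_contra h
  have h2 := integral_undef h
  rw [integral_rpow_mul_heat ha hz] at h2
  have := subConst_pos ha
  exact absurd h2 (by positivity)

lemma lintegral_rpow_mul_heat {a : ℝ} (ha : a < (N : ℝ) / 2) {z : Euc N} (hz : z ≠ 0) :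
    ∫⁻ r in Ioi (0 : ℝ), ENNReal.ofReal (r ^ (a - 1) * heat r z)
      = ENNReal.ofReal (subConst N a * ‖z‖ ^ (2 * a - N)) := by
  rw [← integral_rpow_mul_heat ha hz, ofReal_integral_eq_lintegral_ofReal
    (integrableOn_rpow_mul_heat ha hz)]
  filter_upwards [ae_restrict_mem measurableSet_Ioi] with r hr
  have hr : 0 < r := hr
  have := heat_nonneg hr z
  positivity

end Subordination

section Swap

variable {X V : Type*} [MeasurableSpace X] [MeasurableSpace V] {μ : Measure X} {ν : Measure V}
  [SFinite μ] [SFinite ν]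

/-- Fubini for a nonnegative kernel with known marginal. -/
lemma integral_kernel_swap {k : X → V → ℝ} (hk : Measurable (Function.uncurry k))
    {h κ : V → ℝ} (hh : Measurable h)
    (hk0 : ∀ᵐ v ∂ν, ∀ᵐ x ∂μ, 0 ≤ k x v) (hκ0 : ∀ᵐ v ∂ν, 0 ≤ κ v)
    (hκ : ∀ᵐ v ∂ν, ∫⁻ x, ENNReal.ofReal (k x v) ∂μ = ENNReal.ofReal (κ v))
    (hint : Integrable (fun v => κ v * h v) ν) :
    Integrable (fun p : X × V => k p.1 p.2 * h p.2) (μ.prod ν) ∧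
      ∫ x, ∫ v, k x v * h v ∂ν ∂μ = ∫ v, κ v * h v ∂ν := by
  have hkv : ∀ v, Measurable (fun x => k x v) := fun v =>
    hk.comp (f := fun x => (x, v)) (by fun_prop)
  have h1 : ∀ᵐ v ∂ν, Integrable (fun x => k x v) μ ∧ ∫ x, k x v ∂μ = κ v := by
    filter_upwards [hk0, hκ0, hκ] with v h0 h0' h1
    refine ⟨⟨(hkv v).aestronglyMeasurable, ?_⟩, ?_⟩
    · rw [hasFiniteIntegral_iff_ofReal h0, h1]; exact ENNReal.ofReal_lt_top
    · rw [integral_eq_lintegral_of_nonneg_ae h0 (hkv v).aestronglyMeasurable, h1,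
        ENNReal.toReal_ofReal h0']
  have hm : AEStronglyMeasurable (fun p : X × V => k p.1 p.2 * h p.2) (μ.prod ν) :=
    (Measurable.mul (by exact hk) (hh.comp measurable_snd)).aestronglyMeasurable
  have hI : Integrable (fun p : X × V => k p.1 p.2 * h p.2) (μ.prod ν) := by
    rw [integrable_prod_iff' hm]
    refine ⟨?_, ?_⟩
    · filter_upwards [h1] with v hv using hv.1.mul_const _
    · refine hint.norm.congr ?_
      filter_upwards [h1, hk0, hκ0] with v hv h0 h0'
      have : ∫ x, ‖k x v * h v‖ ∂μ = ∫ x, k x v * ‖h v‖ ∂μ := by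
        refine integral_congr_ae ?_
        filter_upwards [h0] with x hx
        rw [norm_mul, Real.norm_of_nonneg hx]
      rw [this, integral_mul_const, hv.2, norm_mul, Real.norm_of_nonneg h0']
  refine ⟨hI, ?_⟩
  rw [integral_integral_swap hI]
  refine integral_congr_ae ?_
  filter_upwards [h1] with v hv
  rw [integral_mul_const, hv.2]

end Swap

section Weight

variable {N : ℕ}

/-- The weight defining the class `L_{2s}`. -/
noncomputable def wt {N : ℕ} (s : ℝ) (z : Euc N) : ℝ := 1 / (1 + ‖z‖ ^ ((N : ℝ) + 2 * s))

lemma wt_pos (s : ℝ) (z : Euc N) : 0 < wt s z := by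
  unfold wt; positivity

lemma measurable_wt (s : ℝ) : Measurable (fun z : Euc N => wt s z) := by
  unfold wt; fun_prop

lemma one_le_two_mul_wt {s : ℝ} (hs : 0 < s) {z : Euc N} (hz : ‖z‖ ≤ 1) : 1 ≤ 2 * wt s z := by
  unfold wt
  have : ‖z‖ ^ ((N : ℝ) + 2 * s) ≤ 1 := Real.rpow_le_one (norm_nonneg _) hz (by positivity)
  rw [mul_one_div, le_div_iff₀ (by positivity)]
  linarith

lemma rpow_neg_le_two_mul_wt {s : ℝ} (hs : 0 < s) {z : Euc N} (hz : 1 ≤ ‖z‖) :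
    ‖z‖ ^ (-((N : ℝ) + 2 * s)) ≤ 2 * wt s z := by
  unfold wt
  have : 1 ≤ ‖z‖ ^ ((N : ℝ) + 2 * s) := Real.one_le_rpow hz (by positivity)
  rw [Real.rpow_neg (norm_nonneg _), mul_one_div, inv_eq_one_div,
    div_le_div_iff₀ (by positivity) (by positivity)]
  linarith

lemma wt_translate {s : ℝ} (hs : 0 < s) (x : Euc N) :
    ∃ C : ℝ, 0 ≤ C ∧ ∀ y : Euc N, wt s (x - y) ≤ C * wt s y := by
  set q : ℝ := (N : ℝ) + 2 * s with hq
  have hq0 : 0 < q := by positivity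
  refine ⟨1 + 2 ^ q * (1 + ‖x‖ ^ q), by positivity, fun y => ?_⟩
  unfold wt
  rw [← hq, mul_one_div, div_le_div_iff₀ (by positivity) (by positivity), one_mul]
  have h1 : ‖y‖ ^ q ≤ 2 ^ q * (‖x‖ ^ q + ‖x - y‖ ^ q) := by
    have h2 : ‖y‖ ≤ 2 * max ‖x‖ ‖x - y‖ := by
      have : y = x - (x - y) := by abel
      calc ‖y‖ ≤ ‖x‖ + ‖x - y‖ := by
            conv_lhs => rw [this]
            exact norm_sub_le _ _
        _ ≤ _ := by linarith [le_max_left ‖x‖ ‖x - y‖, le_max_right ‖x‖ ‖x - y‖]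
    calc ‖y‖ ^ q ≤ (2 * max ‖x‖ ‖x - y‖) ^ q := by gcongr
      _ = 2 ^ q * (max ‖x‖ ‖x - y‖) ^ q := Real.mul_rpow (by norm_num) (by positivity)
      _ ≤ _ := by
        gcongr
        have a1 : 0 ≤ ‖x‖ ^ q := by positivity
        have a2 : 0 ≤ ‖x - y‖ ^ q := by positivity
        rcases max_choice ‖x‖ ‖x - y‖ with h | h <;> rw [h] <;> linarith
  have a1 : 0 ≤ ‖x‖ ^ q := by positivity
  have a2 : 0 ≤ ‖x - y‖ ^ q := by positivity
  have a3 : 0 ≤ (2 : ℝ) ^ q := by positivity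
  nlinarith [mul_nonneg a3 a1, mul_nonneg a3 a2, mul_nonneg (mul_nonneg a3 a1) a2]

lemma heat_le_wt {s : ℝ} (hs : 0 < s) {b : ℝ} (hb : 0 < b) :
    ∃ C : ℝ, 0 ≤ C ∧ ∀ z : Euc N, heat b z ≤ C * wt s z := by
  set q : ℝ := (N : ℝ) + 2 * s with hq
  have hq0 : 0 < q := by positivity
  obtain ⟨m, hm⟩ := exists_nat_ge q
  refine ⟨(4 * Real.pi * b) ^ (-(N : ℝ) / 2) * (2 + (4 * b) ^ m * m.factorial), by positivity,
    fun z => ?_⟩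
  unfold wt heat
  rw [← hq, mul_one_div, le_div_iff₀ (by positivity), mul_assoc]
  gcongr
  set y := ‖z‖ ^ 2 / (4 * b) with hy
  have hy0 : 0 ≤ y := by positivity
  have e1 : -‖z‖ ^ 2 / (4 * b) = -y := by rw [hy]; ring
  rw [e1]
  have h1 : ‖z‖ ^ q ≤ 1 + (4 * b) ^ m * y ^ m := by
    have e2 : (4 * b) ^ m * y ^ m = ‖z‖ ^ (2 * m) := by
      rw [← mul_pow, hy, pow_mul]; congr 1; field_simp
    rw [e2]
    rcases le_total ‖z‖ 1 with h | h
    · have : ‖z‖ ^ q ≤ 1 := Real.rpow_le_one (norm_nonneg _) h hq0.le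
      have : 0 ≤ ‖z‖ ^ (2 * m) := by positivity
      linarith
    · have : ‖z‖ ^ q ≤ ‖z‖ ^ ((2 * m : ℕ) : ℝ) := by
        apply Real.rpow_le_rpow_of_exponent_le h
        push_cast
        have : (0 : ℝ) ≤ m := by positivity
        linarith
      rw [Real.rpow_natCast] at this
      linarith
  have h2 : y ^ m * Real.exp (-y) ≤ m.factorial := by
    have := Real.pow_div_factorial_le_exp y hy0 m
    rw [div_le_iff₀ (by positivity)] at this
    calc y ^ m * Real.exp (-y) ≤ Real.exp y * m.factorial * Real.exp (-y) := by gcongr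
      _ = m.factorial * (Real.exp y * Real.exp (-y)) := by ring
      _ = _ := by rw [← Real.exp_add]; simp
  have h3 : Real.exp (-y) ≤ 1 := Real.exp_le_one_iff.2 (by linarith)
  have h4 : 0 < Real.exp (-y) := Real.exp_pos _
  calc Real.exp (-y) * (1 + ‖z‖ ^ q) ≤ Real.exp (-y) * (1 + (1 + (4 * b) ^ m * y ^ m)) := by
        gcongr
    _ = 2 * Real.exp (-y) + (4 * b) ^ m * (y ^ m * Real.exp (-y)) := by ring
    _ ≤ 2 * 1 + (4 * b) ^ m * m.factorial := by gcongr
    _ = _ := by ring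

lemma heat_le_wt_of_mem {s : ℝ} (hs : 0 < s) {a b : ℝ} (ha : 0 < a) (hab : a ≤ b) :
    ∃ C : ℝ, 0 ≤ C ∧ ∀ τ ∈ Icc a b, ∀ z : Euc N, heat τ z ≤ C * wt s z := by
  have hb : 0 < b := ha.trans_le hab
  obtain ⟨C, hC, h⟩ := heat_le_wt (N := N) hs hb
  refine ⟨(b / a) ^ ((N : ℝ) / 2) * C, by positivity, fun τ hτ z => ?_⟩
  have hτ0 : 0 < τ := ha.trans_le hτ.1
  calc heat τ z ≤ (b / a) ^ ((N : ℝ) / 2) * heat b z := by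
        refine heat_le_heat_of_ratio hτ0 hτ.2 ?_ z
        rw [div_mul_eq_mul_div, le_div_iff₀ ha]
        have := hτ.1
        have := hτ0.trans_le hτ.2
        nlinarith
    _ ≤ (b / a) ^ ((N : ℝ) / 2) * (C * wt s z) := by gcongr; exact h z
    _ = _ := by ring

lemma heat_scale {c t : ℝ} (hc : 0 < c) (ht : 0 < t) (z : Euc N) :
    heat (c * t) z = c ^ (-(N : ℝ) / 2) * heat t (c ^ (-(1 / 2) : ℝ) • z) := by
  have e : (c ^ (-(1 / 2) : ℝ)) ^ 2 = c⁻¹ := by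
    rw [← Real.rpow_natCast, ← Real.rpow_mul hc.le, ← Real.rpow_neg_one]; norm_num
  unfold heat
  rw [show 4 * Real.pi * (c * t) = c * (4 * Real.pi * t) by ring,
    Real.mul_rpow (by positivity) (by positivity), norm_smul, mul_pow, Real.norm_of_nonneg
    (by positivity), e, mul_assoc]
  congr 3
  field_simp

lemma lintegral_tail_heat_le {s : ℝ} (hs : 0 < s) {a b : ℝ} (ha : 0 < a) (hab : a ≤ b) :
    ∃ C : ℝ, 0 ≤ C ∧ ∀ τ ∈ Icc a b, ∀ z : Euc N,
      ∫⁻ ρ in Ioi (1 : ℝ), ENNReal.ofReal (ρ ^ (-s - 1) * heat (τ + ρ) z)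
        ≤ ENNReal.ofReal (C * wt s z) := by
  have hb : 0 < b := ha.trans_le hab
  set c := 1 + b with hc
  have hc0 : 0 < c := by positivity
  set C1 := (4 * Real.pi * a) ^ (-(N : ℝ) / 2) * (1 / s) with hC1
  set C2 := subConst N (-s) * (c ^ (-(1 / 2) : ℝ)) ^ (-((N : ℝ) + 2 * s)) with hC2
  have hsN : -s < (N : ℝ) / 2 := by
    have : (0 : ℝ) ≤ N := by positivity
    linarith
  have hK := subConst_pos hsN
  refine ⟨2 * C1 + 2 * C2, by positivity, fun τ hτ z => ?_⟩
  have hτ0 : 0 < τ := ha.trans_le hτ.1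
  have hw := wt_pos s z
  rcases le_total ‖z‖ 1 with h | h
  · calc _ ≤ ∫⁻ ρ in Ioi (1 : ℝ), ENNReal.ofReal (ρ ^ (-s - 1) *
          (4 * Real.pi * a) ^ (-(N : ℝ) / 2)) := by
          refine setLIntegral_mono' measurableSet_Ioi fun ρ hρ => ?_
          have hρ : 1 < ρ := hρ
          apply ENNReal.ofReal_le_ofReal
          gcongr
          refine (heat_le_rpow (by linarith) z).trans ?_
          apply Real.rpow_le_rpow_of_nonpos (by positivity)
          · have := hτ.1
            gcongr
            linarith
          · have : (0 : ℝ) ≤ N := by positivity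
            linarith
      _ = ENNReal.ofReal (∫ ρ in Ioi (1 : ℝ), ρ ^ (-s - 1) *
          (4 * Real.pi * a) ^ (-(N : ℝ) / 2)) := by
          rw [ofReal_integral_eq_lintegral_ofReal]
          · exact (integrableOn_Ioi_rpow_of_lt (by linarith) one_pos).mul_const _
          · filter_upwards [ae_restrict_mem measurableSet_Ioi] with ρ hρ
            have hρ : 0 < ρ := one_pos.trans hρ
            positivity
      _ ≤ _ := by
          apply ENNReal.ofReal_le_ofReal
          rw [integral_mul_const, integral_Ioi_rpow_of_lt (by linarith) one_pos]
          have e : -(1 : ℝ) ^ (-s - 1 + 1) / (-s - 1 + 1) = 1 / s := by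
            rw [Real.one_rpow, show -s - 1 + 1 = -s by ring, neg_div_neg_eq]
          rw [e, mul_comm, ← hC1]
          have h1 := one_le_two_mul_wt hs h
          have h2 : 0 ≤ C1 := by positivity
          have h3 : 0 ≤ C2 := by positivity
          nlinarith [mul_nonneg h3 hw.le]
  · have hz : z ≠ 0 := norm_pos_iff.1 (by linarith)
    have hz' : c ^ (-(1 / 2) : ℝ) • z ≠ 0 := smul_ne_zero (by positivity) hz
    calc _ ≤ ∫⁻ ρ in Ioi (1 : ℝ),
          ENNReal.ofReal (ρ ^ (-s - 1) * heat ρ (c ^ (-(1 / 2) : ℝ) • z)) := by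
          refine setLIntegral_mono' measurableSet_Ioi fun ρ hρ => ?_
          have hρ : 1 < ρ := hρ
          apply ENNReal.ofReal_le_ofReal
          gcongr
          have h1 : heat (τ + ρ) z ≤ c ^ ((N : ℝ) / 2) * heat (c * ρ) z := by
            have := hτ.2
            apply heat_le_heat_of_ratio (by positivity)
            · rw [hc]; nlinarith
            · gcongr; linarith
          rw [heat_scale hc0 (by linarith), ← mul_assoc, ← Real.rpow_add hc0] at h1
          simpa [neg_div] using h1
      _ ≤ ∫⁻ ρ in Ioi (0 : ℝ),
          ENNReal.ofReal (ρ ^ (-s - 1) * heat ρ (c ^ (-(1 / 2) : ℝ) • z)) :=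
          lintegral_mono_set (Ioi_subset_Ioi zero_le_one)
      _ = _ := lintegral_rpow_mul_heat hsN hz'
      _ ≤ _ := by
          apply ENNReal.ofReal_le_ofReal
          rw [norm_smul, Real.norm_of_nonneg (by positivity), Real.mul_rpow (by positivity)
            (by positivity), show 2 * -s - (N : ℝ) = -((N : ℝ) + 2 * s) by ring, ← mul_assoc, ← hC2]
          have h1 := rpow_neg_le_two_mul_wt hs h
          have h2 : 0 ≤ C1 := by positivity
          have h3 : 0 ≤ C2 := by positivity
          nlinarith [mul_nonneg h2 hw.le]

/-- The integrand of the Marchaud derivative of the heat kernel in time. -/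
noncomputable def heatDiff {N : ℕ} (s τ ρ : ℝ) (z : Euc N) : ℝ :=
  ρ ^ (-s - 1) * (heat τ z - heat (τ + ρ) z)

/-- The Marchaud derivative of order `s` of the heat kernel in time. -/
noncomputable def heatFrac {N : ℕ} (s τ : ℝ) (z : Euc N) : ℝ :=
  ∫ ρ in Ioi (0 : ℝ), heatDiff s τ ρ z

lemma lintegral_heatDiff_le {s : ℝ} (hs : 0 < s) (hs1 : s < 1) {a b : ℝ} (ha : 0 < a)
    (hab : a ≤ b) :
    ∃ C : ℝ, 0 ≤ C ∧ ∀ τ ∈ Icc a b, ∀ z : Euc N,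
      ∫⁻ ρ in Ioi (0 : ℝ), ENNReal.ofReal |heatDiff s τ ρ z| ≤ ENNReal.ofReal (C * wt s z) := by
  obtain ⟨C1, hC1, h1⟩ := heat_le_wt_of_mem (N := N) hs (show 0 < 2 * a by positivity)
    (show 2 * a ≤ 2 * (b + 1) by linarith)
  obtain ⟨C2, hC2, h2⟩ := heat_le_wt_of_mem (N := N) hs ha hab
  obtain ⟨C3, hC3, h3⟩ := lintegral_tail_heat_le (N := N) hs ha hab
  set K : ℝ := (2 + N / 2) * (2 : ℝ) ^ ((N : ℝ) / 2) * (a⁻¹ * C1) with hK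
  have hK0 : 0 ≤ K := by positivity
  have h1s : 0 < 1 - s := by linarith
  refine ⟨K * (1 / (1 - s)) + C2 * (1 / s) + C3, by positivity, fun τ hτ z => ?_⟩
  have hτ0 : 0 < τ := ha.trans_le hτ.1
  have hw := wt_pos s z
  have near : ∀ ρ ∈ Ioc (0 : ℝ) 1, |heatDiff s τ ρ z| ≤ ρ ^ (-s) * (K * wt s z) := by
    intro ρ hρ
    have hmv : |heat (τ + ρ) z - heat τ z| ≤ K * wt s z * |τ + ρ - τ| := by
      have := Convex.norm_image_sub_le_of_norm_hasDerivWithin_le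
        (f := fun t => heat t z) (f' := fun t => heatDeriv t z) (s := Icc τ (τ + ρ))
        (C := K * wt s z) (x := τ) (y := τ + ρ)
        (fun σ hσ => (hasDerivAt_heat (hτ0.trans_le hσ.1) z).hasDerivWithinAt)
        (fun σ hσ => ?_) (convex_Icc _ _) (left_mem_Icc.2 (by linarith [hρ.1]))
        (right_mem_Icc.2 (by linarith [hρ.1]))
      · simpa [Real.norm_eq_abs] using this
      · have hσ0 : a ≤ σ := hτ.1.trans hσ.1
        have hσ00 : 0 < σ := ha.trans_le hσ0
        refine (abs_heatDeriv_le hσ00 z).trans ?_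
        rw [hK, mul_assoc _ (a⁻¹ * C1), mul_assoc a⁻¹]
        have := h1 (2 * σ) ⟨by linarith, by linarith [hσ.2, hτ.2, hρ.2]⟩ z
        have := heat_nonneg (show 0 < 2 * σ by linarith) z
        gcongr
    unfold heatDiff
    have hρ0 : 0 < ρ := hρ.1
    rw [abs_mul, abs_of_pos (by positivity : 0 < ρ ^ (-s - 1)), abs_sub_comm]
    have e : ρ ^ (-s) = ρ ^ (-s - 1) * ρ := by
      rw [← Real.rpow_add_one hρ0.ne']; congr 1; ring
    rw [e, mul_assoc]
    gcongr
    rw [add_sub_cancel_left, abs_of_pos hρ0] at hmv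
    linarith
  have far : ∀ ρ ∈ Ioi (1 : ℝ), |heatDiff s τ ρ z|
      ≤ ρ ^ (-s - 1) * (C2 * wt s z) + ρ ^ (-s - 1) * heat (τ + ρ) z := by
    intro ρ hρ
    have hρ0 : 0 < ρ := one_pos.trans hρ
    unfold heatDiff
    rw [abs_mul, abs_of_pos (by positivity : 0 < ρ ^ (-s - 1)), ← mul_add]
    gcongr
    have a1 := heat_nonneg hτ0 z
    have a2 := heat_nonneg (show 0 < τ + ρ by linarith) z
    have a3 := h2 τ hτ z
    rw [abs_le]; constructor <;> linarith
  have hd : Ioi (0 : ℝ) = Ioc 0 1 ∪ Ioi 1 := (Ioc_union_Ioi_eq_Ioi zero_le_one).symm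
  have b1 : ∫⁻ ρ in Ioc (0 : ℝ) 1, ENNReal.ofReal |heatDiff s τ ρ z|
      ≤ ENNReal.ofReal (K * (1 / (1 - s)) * wt s z) := by
    calc _ ≤ ∫⁻ ρ in Ioc (0 : ℝ) 1, ENNReal.ofReal (ρ ^ (-s) * (K * wt s z)) :=
          setLIntegral_mono' measurableSet_Ioc fun ρ hρ => ENNReal.ofReal_le_ofReal (near ρ hρ)
      _ = ENNReal.ofReal (∫ ρ in Ioc (0 : ℝ) 1, ρ ^ (-s) * (K * wt s z)) := by
          rw [ofReal_integral_eq_lintegral_ofReal]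
          · refine Integrable.mul_const ?_ _
            exact (intervalIntegrable_iff_integrableOn_Ioc_of_le zero_le_one).1
              (intervalIntegral.intervalIntegrable_rpow' (by linarith))
          · filter_upwards [ae_restrict_mem measurableSet_Ioc] with ρ hρ
            have hρ : 0 < ρ := hρ.1
            positivity
      _ ≤ _ := by
          apply ENNReal.ofReal_le_ofReal
          rw [integral_mul_const, ← intervalIntegral.integral_of_le zero_le_one,
            integral_rpow (Or.inl (by linarith)), Real.one_rpow, Real.zero_rpow (by linarith)]
          apply le_of_eq
          rw [show -s + 1 = 1 - s by ring]
          ring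
  have b2 : ∫⁻ ρ in Ioi (1 : ℝ), ENNReal.ofReal |heatDiff s τ ρ z|
      ≤ ENNReal.ofReal (C2 * (1 / s) * wt s z) + ENNReal.ofReal (C3 * wt s z) := by
    calc _ ≤ ∫⁻ ρ in Ioi (1 : ℝ), (ENNReal.ofReal (ρ ^ (-s - 1) * (C2 * wt s z))
          + ENNReal.ofReal (ρ ^ (-s - 1) * heat (τ + ρ) z)) := by
          refine setLIntegral_mono' measurableSet_Ioi fun ρ hρ => ?_
          exact (ENNReal.ofReal_le_ofReal (far ρ hρ)).trans ENNReal.ofReal_add_le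
      _ = (∫⁻ ρ in Ioi (1 : ℝ), ENNReal.ofReal (ρ ^ (-s - 1) * (C2 * wt s z)))
          + ∫⁻ ρ in Ioi (1 : ℝ), ENNReal.ofReal (ρ ^ (-s - 1) * heat (τ + ρ) z) :=
          lintegral_add_left (f := fun ρ : ℝ => ENNReal.ofReal (ρ ^ (-s - 1) * (C2 * wt s z)))
            (by fun_prop) _
      _ ≤ _ := by
          refine add_le_add ?_ ?_
          · rw [← ofReal_integral_eq_lintegral_ofReal]
            · apply ENNReal.ofReal_le_ofReal
              rw [integral_mul_const, integral_Ioi_rpow_of_lt (by linarith) one_pos]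
              have e : -(1 : ℝ) ^ (-s - 1 + 1) / (-s - 1 + 1) = 1 / s := by
                rw [Real.one_rpow, show -s - 1 + 1 = -s by ring, neg_div_neg_eq]
              rw [e]; apply le_of_eq; ring
            · exact (integrableOn_Ioi_rpow_of_lt (by linarith) one_pos).mul_const _
            · filter_upwards [ae_restrict_mem measurableSet_Ioi] with ρ hρ
              have hρ : 0 < ρ := one_pos.trans hρ
              positivity
          · exact h3 τ hτ z
  calc _ ≤ _ := by rw [hd]; exact lintegral_union_le _ _ _
    _ ≤ ENNReal.ofReal (K * (1 / (1 - s)) * wt s z) +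
        (ENNReal.ofReal (C2 * (1 / s) * wt s z) + ENNReal.ofReal (C3 * wt s z)) := add_le_add b1 b2
    _ = _ := by
        rw [← ENNReal.ofReal_add (by positivity) (by positivity),
          ← ENNReal.ofReal_add (by positivity) (by positivity)]
        congr 1; ring

lemma measurable_heatDiff (s : ℝ) :
    Measurable (fun p : (ℝ × Euc N) × ℝ => heatDiff s p.1.1 p.2 p.1.2) := by
  unfold heatDiff
  have h := measurable_heat (N := N)
  refine Measurable.mul (by fun_prop) (Measurable.sub ?_ ?_)
  · exact h.comp measurable_fst
  · exact h.comp (f := fun p : (ℝ × Euc N) × ℝ => (p.1.1 + p.2, p.1.2)) (by fun_prop)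

lemma measurable_heatFrac (s : ℝ) :
    Measurable (fun p : ℝ × Euc N => heatFrac s p.1 p.2) := by
  unfold heatFrac
  exact (measurable_heatDiff s).stronglyMeasurable.integral_prod_right.measurable

lemma abs_heatFrac_le {s : ℝ} (hs : 0 < s) (hs1 : s < 1) {a b : ℝ} (ha : 0 < a) (hab : a ≤ b) :
    ∃ C : ℝ, 0 ≤ C ∧ ∀ τ ∈ Icc a b, ∀ z : Euc N, |heatFrac s τ z| ≤ C * wt s z := by
  obtain ⟨C, hC, h⟩ := lintegral_heatDiff_le (N := N) hs hs1 ha hab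
  refine ⟨C, hC, fun τ hτ z => ?_⟩
  have hw := wt_pos s z
  unfold heatFrac
  rw [← Real.norm_eq_abs]
  refine (norm_integral_le_lintegral_norm _).trans ?_
  exact ENNReal.toReal_le_of_le_ofReal (by positivity) (h τ hτ z)

end Weight

section Abel

/-- The density of the (unnormalised) Beta distribution with parameters `s` and `1 - s`. -/
noncomputable def betaFun (s w : ℝ) : ℝ := w ^ (s - 1) * (1 - w) ^ (-s)

/-- The total mass of `betaFun` on the unit interval. -/
noncomputable def betaMass (s : ℝ) : ℝ := ∫ w in Ioo (0 : ℝ) 1, betaFun s w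

lemma measurable_betaFun (s : ℝ) : Measurable (betaFun s) := by
  unfold betaFun; fun_prop

lemma betaFun_pos (s : ℝ) {w : ℝ} (hw : w ∈ Ioo (0 : ℝ) 1) : 0 < betaFun s w := by
  unfold betaFun
  have h1 := hw.1
  have h2 : 0 < 1 - w := sub_pos.2 hw.2
  positivity

lemma integrableOn_betaFun {s : ℝ} (hs : 0 < s) (hs1 : s < 1) :
    IntegrableOn (betaFun s) (Ioo 0 1) := by
  have h := Complex.betaIntegral_convergent (u := (s : ℂ)) (v := ((1 - s : ℝ) : ℂ))
    (by simpa using hs) (by simpa using hs1)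
  rw [intervalIntegrable_iff_integrableOn_Ioo_of_le zero_le_one] at h
  refine h.norm.congr ?_
  filter_upwards [ae_restrict_mem measurableSet_Ioo] with w hw
  have h2 : 0 < 1 - w := sub_pos.2 hw.2
  rw [norm_mul, Complex.norm_cpow_eq_rpow_re_of_pos hw.1,
    show (1 : ℂ) - (w : ℂ) = ((1 - w : ℝ) : ℂ) by push_cast; rfl,
    Complex.norm_cpow_eq_rpow_re_of_pos h2]
  simp [betaFun]

lemma betaMass_pos {s : ℝ} (hs : 0 < s) (hs1 : s < 1) : 0 < betaMass s := by
  unfold betaMass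
  rw [setIntegral_pos_iff_support_of_nonneg_ae _ (integrableOn_betaFun hs hs1)]
  · have : Function.support (betaFun s) ∩ Ioo (0 : ℝ) 1 = Ioo 0 1 :=
      inter_eq_right.2 fun w hw => (betaFun_pos s hw).ne'
    rw [this]; simp
  · filter_upwards [ae_restrict_mem measurableSet_Ioo] with w hw using (betaFun_pos s hw).le

lemma lintegral_mul_left_eq {G : ℝ → ENNReal} (hG : Measurable G) {v : ℝ} (hv : 0 < v) :
    ∫⁻ r, G r = ENNReal.ofReal v * ∫⁻ w, G (v * w) := by
  conv_lhs => rw [← Real.smul_map_volume_mul_left hv.ne']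
  rw [lintegral_smul_measure, lintegral_map hG (by fun_prop), abs_of_pos hv, smul_eq_mul]

lemma lintegral_abel_kernel {s : ℝ} (hs : 0 < s) {v R : ℝ} (hv : 0 < v) :
    ∫⁻ p : ℝ × ℝ, ENNReal.ofReal (if p.1 < v ∧ v ≤ p.1 + p.2 then
        p.1 ^ (s - 1) * p.2 ^ (-s - 1) else 0)
        ∂((volume.restrict (Ioo 0 R)).prod (volume.restrict (Ioi 0)))
      = ∫⁻ w in Ioo (0 : ℝ) 1, ENNReal.ofReal (if v * w < R then betaFun s w / s else 0) := by
  have hm : Measurable (fun p : ℝ × ℝ => ENNReal.ofReal (if p.1 < v ∧ v ≤ p.1 + p.2 then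
        p.1 ^ (s - 1) * p.2 ^ (-s - 1) else 0)) := by
    refine Measurable.ennreal_ofReal (Measurable.ite ?_ (by fun_prop) (by fun_prop))
    exact (measurableSet_lt measurable_fst measurable_const).inter
      (measurableSet_le measurable_const (measurable_fst.add measurable_snd))
  rw [lintegral_prod _ hm.aemeasurable]
  have inner : ∀ r ∈ Ioo 0 R, ∫⁻ ρ in Ioi (0 : ℝ), ENNReal.ofReal (if r < v ∧ v ≤ r + ρ then
        r ^ (s - 1) * ρ ^ (-s - 1) else 0)
      = ENNReal.ofReal (if r < v then r ^ (s - 1) * (v - r) ^ (-s) / s else 0) := by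
    intro r hr
    have hr0 : 0 < r := hr.1
    by_cases h : r < v
    · have hvr : 0 < v - r := sub_pos.2 h
      have e : ∀ ρ, ENNReal.ofReal (if r < v ∧ v ≤ r + ρ then
          r ^ (s - 1) * ρ ^ (-s - 1) else 0)
          = (Ici (v - r)).indicator (fun ρ => ENNReal.ofReal (r ^ (s - 1) * ρ ^ (-s - 1))) ρ := by
        intro ρ
        by_cases h2 : v ≤ r + ρ
        · rw [if_pos ⟨h, h2⟩, indicator_of_mem]; exact sub_le_iff_le_add'.2 h2
        · rw [if_neg (fun h3 => h2 h3.2), indicator_of_notMem, ENNReal.ofReal_zero]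
          exact fun h3 => h2 (sub_le_iff_le_add'.1 h3)
      simp_rw [e]
      rw [lintegral_indicator measurableSet_Ici, Measure.restrict_restrict measurableSet_Ici,
        inter_eq_left.2 (Ici_subset_Ioi.2 hvr), if_pos h,
        setLIntegral_congr Ioi_ae_eq_Ici.symm, ← ofReal_integral_eq_lintegral_ofReal]
      · congr 1
        rw [integral_const_mul, integral_Ioi_rpow_of_lt (by linarith) hvr,
          show -s - 1 + 1 = -s by ring, neg_div_neg_eq]
        ring
      · exact (integrableOn_Ioi_rpow_of_lt (by linarith) hvr).const_mul _
      · filter_upwards [ae_restrict_mem measurableSet_Ioi] with ρ hρ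
        have hρ : 0 < ρ := hvr.trans hρ
        positivity
    · simp [h]
  rw [setLIntegral_congr_fun measurableSet_Ioo inner, ← lintegral_indicator measurableSet_Ioo,
    ← lintegral_indicator measurableSet_Ioo]
  rw [lintegral_mul_left_eq _ hv, ← lintegral_const_mul']
  · congr 1
    ext w
    simp only [indicator]
    by_cases hw : w ∈ Ioo (0 : ℝ) 1
    · by_cases h : v * w < R
      · have h1 : v * w ∈ Ioo 0 R := ⟨mul_pos hv hw.1, h⟩
        have h2 : v * w < v := by nlinarith [hw.2]
        rw [if_pos hw, if_pos h1, if_pos h2, if_pos h, ← ENNReal.ofReal_mul hv.le]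
        congr 1
        unfold betaFun
        have h3 : 0 < 1 - w := sub_pos.2 hw.2
        rw [show v - v * w = v * (1 - w) by ring, Real.mul_rpow hv.le hw.1.le,
          Real.mul_rpow hv.le h3.le]
        have : v * v ^ (s - 1) * v ^ (-s) = 1 := by
          rw [← Real.rpow_one_add' hv.le (by linarith), ← Real.rpow_add hv]
          simp
        calc _ = (v * v ^ (s - 1) * v ^ (-s)) * (w ^ (s - 1) * (1 - w) ^ (-s) / s) := by ring
          _ = _ := by rw [this, one_mul]
      · have h1 : v * w ∉ Ioo 0 R := fun h1 => h h1.2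
        rw [if_pos hw, if_neg h1, if_neg h]; simp
    · rw [if_neg hw]
      by_cases h1 : v * w ∈ Ioo 0 R
      · have h2 : ¬ v * w < v := fun h2 => hw ⟨pos_of_mul_pos_right h1.1 hv.le, by
          nlinarith⟩
        rw [if_pos h1, if_neg h2]; simp
      · rw [if_neg h1]; simp
  · exact ENNReal.ofReal_ne_top
  · refine Measurable.indicator ?_ measurableSet_Ioo
    exact Measurable.ennreal_ofReal (Measurable.ite measurableSet_Iio (by fun_prop) (by fun_prop))

/-- Abel's identity: integrating a Marchaud derivative against `r^(s-1)`. -/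
lemma integral_rpow_mul_marchaud {s : ℝ} (hs : 0 < s) (hs1 : s < 1) {g g' : ℝ → ℝ}
    (hg : ∀ v, 0 ≤ v → HasDerivAt g (g' v) v) (hg'm : Measurable g')
    (hg' : IntegrableOn g' (Ioi 0)) {R : ℝ} (hR : 0 < R) :
    ∫ r in Ioo 0 R, r ^ (s - 1) * ∫ ρ in Ioi (0 : ℝ), ρ ^ (-s - 1) * (g r - g (r + ρ))
      = (1 / s) * ∫ w in Ioo (0 : ℝ) 1, betaFun s w * (g 0 - g (R / w)) := by
  have ftc : ∀ a b, 0 ≤ a → a ≤ b → ∫ v in Ioc a b, -g' v = g a - g b := by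
    intro a b ha hab
    rw [integral_neg, ← intervalIntegral.integral_of_le hab,
      intervalIntegral.integral_eq_sub_of_hasDerivAt (f := g)]
    · ring
    · intro x hx
      rw [uIcc_of_le hab] at hx
      exact hg x (ha.trans hx.1)
    · rw [intervalIntegrable_iff_integrableOn_Ioc_of_le hab]
      exact hg'.mono_set fun x hx => ha.trans_lt hx.1
  set k1 : ℝ × ℝ → ℝ → ℝ := fun p v => if p.1 < v ∧ v ≤ p.1 + p.2 then
        p.1 ^ (s - 1) * p.2 ^ (-s - 1) else 0 with hk1
  set k2 : ℝ → ℝ → ℝ := fun w v => if v * w < R then betaFun s w / s else 0 with hk2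
  have mk1 : Measurable (Function.uncurry k1) := by
    simp only [hk1, Function.uncurry_def]
    refine Measurable.ite ?_ (by fun_prop) (by fun_prop)
    exact (measurableSet_lt (f := fun q : (ℝ × ℝ) × ℝ => q.1.1) (g := fun q => q.2)
      (by fun_prop) (by fun_prop)).inter (measurableSet_le (f := fun q : (ℝ × ℝ) × ℝ => q.2)
      (g := fun q => q.1.1 + q.1.2) (by fun_prop) (by fun_prop))
  have mk2 : Measurable (Function.uncurry k2) := by
    simp only [hk2, Function.uncurry_def]
    have := measurable_betaFun s
    refine Measurable.ite ?_ (by fun_prop) (by fun_prop)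
    exact measurableSet_lt (by fun_prop) (by fun_prop)
  set K : ℝ → ENNReal := fun v => ∫⁻ w in Ioo (0 : ℝ) 1, ENNReal.ofReal (k2 w v) with hK
  have mK : Measurable K := by
    have : Measurable (fun p : ℝ × ℝ => ENNReal.ofReal (k2 p.2 p.1)) :=
      (mk2.comp measurable_swap).ennreal_ofReal
    exact this.lintegral_prod_right
  have hKle : ∀ v, K v ≤ ENNReal.ofReal (betaMass s / s) := by
    intro v
    unfold betaMass
    rw [← integral_div, ofReal_integral_eq_lintegral_ofReal
      ((integrableOn_betaFun hs hs1).div_const _)]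
    · refine setLIntegral_mono' measurableSet_Ioo fun w hw => ENNReal.ofReal_le_ofReal ?_
      have := betaFun_pos s hw
      simp only [hk2]
      split_ifs
      · exact le_rfl
      · positivity
    · filter_upwards [ae_restrict_mem measurableSet_Ioo] with w hw
      have := betaFun_pos s hw
      positivity
  have hKtop : ∀ v, K v ≠ ⊤ := fun v => ((hKle v).trans_lt ENNReal.ofReal_lt_top).ne
  have hB := betaMass_pos hs hs1
  have hint : Integrable (fun v => (K v).toReal * -g' v) (volume.restrict (Ioi 0)) := by
    refine Integrable.bdd_mul (c := betaMass s / s) hg'.neg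
      mK.ennreal_toReal.aestronglyMeasurable (ae_of_all _ fun v => ?_)
    rw [Real.norm_of_nonneg ENNReal.toReal_nonneg]
    exact ENNReal.toReal_le_of_le_ofReal (by positivity) (hKle v)
  have S1 := integral_kernel_swap (μ := (volume.restrict (Ioo 0 R)).prod (volume.restrict (Ioi 0)))
    (ν := volume.restrict (Ioi (0 : ℝ))) mk1 (h := fun v => -g' v) (κ := fun v => (K v).toReal)
    hg'm.neg ?_ (ae_of_all _ fun v => ENNReal.toReal_nonneg) ?_ hint
  · have S2 := integral_kernel_swap (μ := volume.restrict (Ioo (0 : ℝ) 1))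
      (ν := volume.restrict (Ioi (0 : ℝ))) mk2 (h := fun v => -g' v) (κ := fun v => (K v).toReal)
      hg'm.neg ?_ (ae_of_all _ fun v => ENNReal.toReal_nonneg) ?_ hint
    · have i1 : ∀ p ∈ Ioo 0 R ×ˢ Ioi (0 : ℝ), ∫ v in Ioi (0 : ℝ), k1 p v * -g' v
          = p.1 ^ (s - 1) * (p.2 ^ (-s - 1) * (g p.1 - g (p.1 + p.2))) := by
        intro p hp
        have hp1 : 0 < p.1 := hp.1.1
        have hp2 : 0 < p.2 := hp.2
        have e : ∀ v, k1 p v * -g' v = (Ioc p.1 (p.1 + p.2)).indicator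
            (fun v => p.1 ^ (s - 1) * p.2 ^ (-s - 1) * -g' v) v := by
          intro v
          simp only [hk1, indicator, mem_Ioc, ite_mul, zero_mul]
        simp_rw [e]
        rw [setIntegral_indicator measurableSet_Ioc, inter_eq_right.2
          (Ioc_subset_Ioi_self.trans (Ioi_subset_Ioi hp1.le)), integral_const_mul, ftc _ _ hp1.le (by linarith)]
        ring
      have i2 : ∀ w ∈ Ioo (0 : ℝ) 1, ∫ v in Ioi (0 : ℝ), k2 w v * -g' v
          = (1 / s) * (betaFun s w * (g 0 - g (R / w))) := by
        intro w hw
        have hw0 : 0 < w := hw.1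
        have e : ∀ v, k2 w v * -g' v = (Iio (R / w)).indicator
            (fun v => betaFun s w / s * -g' v) v := by
          intro v
          simp only [hk2, indicator, mem_Iio, ite_mul, zero_mul, lt_div_iff₀ hw0]
        simp_rw [e]
        rw [setIntegral_indicator measurableSet_Iio, Ioi_inter_Iio, integral_const_mul,
          ← integral_Ioc_eq_integral_Ioo, ftc _ _ le_rfl (by positivity)]
        ring
      have J1 := S1.1.integral_prod_left
      have J := S1.2.trans S2.2.symm
      rw [setIntegral_congr_fun measurableSet_Ioo i2, integral_const_mul, integral_prod _ J1] at J
      rw [← J]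
      refine setIntegral_congr_fun measurableSet_Ioo fun r hr => ?_
      simp only
      rw [← integral_const_mul]
      exact setIntegral_congr_fun measurableSet_Ioi fun ρ hρ => (i1 (r, ρ) ⟨hr, hρ⟩).symm
    · refine ae_of_all _ fun v => ?_
      filter_upwards [ae_restrict_mem measurableSet_Ioo] with w hw
      have := betaFun_pos s hw
      simp only [hk2]
      split_ifs <;> positivity
    · exact ae_of_all _ fun v => (ENNReal.ofReal_toReal (hKtop v)).symm
  · refine ae_of_all _ fun v => ?_
    rw [Measure.prod_restrict]
    filter_upwards [ae_restrict_mem (measurableSet_Ioo.prod measurableSet_Ioi)] with p hp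
    have hp1 : 0 < p.1 := hp.1.1
    have hp2 : 0 < p.2 := hp.2
    simp only [hk1]
    split_ifs <;> positivity
  · filter_upwards [ae_restrict_mem measurableSet_Ioi] with v hv
    rw [ENNReal.ofReal_toReal (hKtop v)]
    exact lintegral_abel_kernel hs hv

end Abel

section HeatAbel

variable {N : ℕ}

/-- The average of the heat kernel over times `t + R / w` against the Beta density. -/
noncomputable def heatMean {N : ℕ} (s t R : ℝ) (z : Euc N) : ℝ :=
  ∫ w in Ioo (0 : ℝ) 1, betaFun s w * heat (t + R / w) z

lemma integrableOn_betaFun_mul_heat {s : ℝ} (hs : 0 < s) (hs1 : s < 1) {t R : ℝ} (ht : 0 < t)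
    (hR : 0 < R) (z : Euc N) :
    IntegrableOn (fun w => betaFun s w * heat (t + R / w) z) (Ioo 0 1) := by
  have h1 := measurable_heat (N := N)
  refine Integrable.mul_bdd (c := (4 * Real.pi * t) ^ (-(N : ℝ) / 2)) (integrableOn_betaFun hs hs1)
    (h1.comp (f := fun w : ℝ => (t + R / w, z)) (by fun_prop)).aestronglyMeasurable ?_
  filter_upwards [ae_restrict_mem measurableSet_Ioo] with w hw
  have hw0 : 0 < w := hw.1
  have h : 0 < t + R / w := by positivity
  rw [Real.norm_of_nonneg (heat_nonneg h z)]
  refine (heat_le_rpow h z).trans (Real.rpow_le_rpow_of_nonpos (by positivity) ?_ ?_)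
  · have : 0 < R / w := by positivity
    gcongr; linarith
  · have : (0 : ℝ) ≤ N := by positivity
    linarith

lemma heatMean_nonneg (s : ℝ) {t R : ℝ} (ht : 0 < t) (hR : 0 < R) (z : Euc N) :
    0 ≤ heatMean s t R z := by
  refine setIntegral_nonneg measurableSet_Ioo fun w hw => ?_
  have hw0 : 0 < w := hw.1
  exact mul_nonneg (betaFun_pos s hw).le (heat_nonneg (by positivity) z)

lemma integrableOn_heatDeriv (hN : 0 < N) {t : ℝ} (ht : 0 < t) (z : Euc N) :
    IntegrableOn (fun v => heatDeriv (t + v) z) (Ioi 0) := by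
  have hN' : (0 : ℝ) < N := by exact_mod_cast hN
  set K : ℝ := (2 + N / 2) * (2 : ℝ) ^ ((N : ℝ) / 2) * (8 * Real.pi) ^ (-(N : ℝ) / 2) with hK
  have h1 : IntegrableOn (fun v : ℝ => K * (v + t) ^ (-(N : ℝ) / 2 - 1)) (Ioi 0) :=
    (integrableOn_add_rpow_Ioi_of_lt (by linarith) (by linarith)).const_mul _
  refine Integrable.mono' h1 ?_ ?_
  · exact (measurable_heatDeriv.comp (f := fun v : ℝ => (t + v, z))
      (by fun_prop)).aestronglyMeasurable
  · filter_upwards [ae_restrict_mem measurableSet_Ioi] with v hv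
    have hv : 0 < v := hv
    have htv : 0 < v + t := by positivity
    rw [add_comm t v, Real.norm_eq_abs]
    refine (abs_heatDeriv_le htv z).trans ?_
    have h2 := heat_le_rpow (show 0 < 2 * (v + t) by positivity) z
    rw [show 4 * Real.pi * (2 * (v + t)) = 8 * Real.pi * (v + t) by ring,
      Real.mul_rpow (by positivity) (by positivity)] at h2
    rw [Real.rpow_sub_one htv.ne']
    calc _ ≤ (2 + N / 2) * (2 : ℝ) ^ ((N : ℝ) / 2) *
          ((v + t)⁻¹ * ((8 * Real.pi) ^ (-(N : ℝ) / 2) * (v + t) ^ (-(N : ℝ) / 2))) := by gcongr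
      _ = _ := by rw [hK]; field_simp

lemma integral_rpow_mul_heatFrac (hN : 0 < N) {s : ℝ} (hs : 0 < s) (hs1 : s < 1) {t R : ℝ}
    (ht : 0 < t) (hR : 0 < R) (z : Euc N) :
    ∫ r in Ioo 0 R, r ^ (s - 1) * heatFrac s (t + r) z
      = (1 / s) * (betaMass s * heat t z - heatMean s t R z) := by
  have h := integral_rpow_mul_marchaud hs hs1 (g := fun v => heat (t + v) z)
    (g' := fun v => heatDeriv (t + v) z) (fun v hv => ?_) ?_ (integrableOn_heatDeriv hN ht z) hR
  · simp only [heatFrac, heatDiff, add_assoc]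
    rw [h]
    simp only [add_zero, mul_sub]
    rw [integral_sub ((integrableOn_betaFun hs hs1).mul_const _)
      (integrableOn_betaFun_mul_heat hs hs1 ht hR z), integral_mul_const]
    simp only [betaMass, heatMean, mul_sub]
  · exact (hasDerivAt_heat (by linarith) z).comp_const_add t v
  · exact measurable_heatDeriv.comp (f := fun v : ℝ => (t + v, z)) (by fun_prop)

end HeatAbel

section SecondDifference

variable {N : ℕ}

lemma integrable_min_div_rpow (hN : 0 < N) {s : ℝ} (hs : 0 < s) (hs1 : s < 1) :
    Integrable (fun z : Euc N => min (‖z‖ ^ 2) 1 / ‖z‖ ^ ((N : ℝ) + 2 * s)) := by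
  have : NeZero N := ⟨hN.ne'⟩
  have : Nontrivial (Euc N) := by
    apply Module.nontrivial_of_finrank_pos (R := ℝ); simpa using hN
  rw [integrable_fun_norm_addHaar volume
    (f := fun y => min (y ^ 2) 1 / y ^ ((N : ℝ) + 2 * s)), finrank_euclideanSpace_fin,
    ← Ioc_union_Ioi_eq_Ioi zero_le_one]
  have e : ∀ y : ℝ, 0 < y → y ^ (N - 1) = y ^ ((N : ℝ) - 1) := by
    intro y hy
    rw [← Real.rpow_natCast, Nat.cast_sub hN, Nat.cast_one]
  refine IntegrableOn.union ?_ ?_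
  · have h : IntegrableOn (fun y : ℝ => y ^ (1 - 2 * s)) (Ioc 0 1) :=
      (intervalIntegrable_iff_integrableOn_Ioc_of_le zero_le_one).1
        (intervalIntegral.intervalIntegrable_rpow' (by linarith))
    refine h.congr_fun (fun y hy => ?_) measurableSet_Ioc
    have hy0 : 0 < y := hy.1
    simp only [smul_eq_mul]
    rw [min_eq_left (by have := hy.2; nlinarith), e y hy0, ← Real.rpow_natCast y 2,
      ← Real.rpow_sub hy0, ← Real.rpow_add hy0]
    congr 1; push_cast; ring
  · have h : IntegrableOn (fun y : ℝ => y ^ (-1 - 2 * s)) (Ioi 1) :=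
      integrableOn_Ioi_rpow_of_lt (by linarith) one_pos
    refine h.congr_fun (fun y hy => ?_) measurableSet_Ioi
    have hy1 : 1 < y := hy
    have hy0 : 0 < y := one_pos.trans hy1
    simp only [smul_eq_mul]
    rw [min_eq_right (by nlinarith), e y hy0, one_div, ← Real.rpow_neg hy0.le,
      ← Real.rpow_add hy0]
    congr 1; ring

lemma integrable_secondDiff_div (hN : 0 < N) {s : ℝ} (hs : 0 < s) (hs1 : s < 1) {D : Euc N → ℝ}
    (hD : Measurable D) {C : ℝ} (h : ∀ z, |D z| ≤ C * min (‖z‖ ^ 2) 1) :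
    Integrable (fun z : Euc N => D z / ‖z‖ ^ ((N : ℝ) + 2 * s)) := by
  refine Integrable.mono' ((integrable_min_div_rpow hN hs hs1).const_mul C)
    (hD.div (by fun_prop)).aestronglyMeasurable (ae_of_all _ fun z => ?_)
  rw [norm_div, Real.norm_eq_abs, Real.norm_of_nonneg (by positivity), ← mul_div_assoc]
  gcongr
  exact h z

lemma exists_abs_secondDiff_le (φ : SchwartzMap (Euc N) ℝ) :
    ∃ C : ℝ, 0 ≤ C ∧ ∀ x z, |2 * φ x - φ (x + z) - φ (x - z)| ≤ C * min (‖z‖ ^ 2) 1 := by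
  set φ1 := SchwartzMap.fderivCLM ℝ (Euc N) ℝ φ with hφ1
  set φ2 := SchwartzMap.fderivCLM ℝ (Euc N) _ φ1 with hφ2
  set M0 := SchwartzMap.seminorm ℝ 0 0 φ
  set M2 := SchwartzMap.seminorm ℝ 0 0 φ2
  have hM0 : 0 ≤ M0 := apply_nonneg _ _
  have hM2 : 0 ≤ M2 := apply_nonneg _ _
  have b0 : ∀ x, |φ x| ≤ M0 := fun x => SchwartzMap.norm_le_seminorm ℝ φ x
  have hlip : ∀ x y, ‖φ1 x - φ1 y‖ ≤ M2 * ‖x - y‖ := fun x y =>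
    Convex.norm_image_sub_le_of_norm_fderiv_le (𝕜 := ℝ) (s := univ)
      (fun z _ => φ1.differentiableAt)
      (fun z _ => SchwartzMap.norm_le_seminorm ℝ φ2 z) convex_univ (mem_univ _) (mem_univ _)
  refine ⟨2 * M2 + 4 * M0, by positivity, fun x z => ?_⟩
  have h1 : |2 * φ x - φ (x + z) - φ (x - z)| ≤ 2 * M2 * ‖z‖ ^ 2 := by
    have hder : ∀ y, HasFDerivAt (fun y => φ (x + y) + φ (x - y)) (φ1 (x + y) - φ1 (x - y)) y := by
      intro y
      have a1 := (φ.differentiableAt.hasFDerivAt (x := x + y)).comp y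
        ((hasFDerivAt_id (𝕜 := ℝ) y).const_add x)
      have a2 := (φ.differentiableAt.hasFDerivAt (x := x - y)).comp y
        ((hasFDerivAt_id (𝕜 := ℝ) y).const_sub x)
      refine (a1.add a2).congr_fderiv ?_
      ext v
      simp [hφ1, SchwartzMap.fderivCLM_apply, sub_eq_add_neg]
    have := Convex.norm_image_sub_le_of_norm_hasFDerivWithin_le (𝕜 := ℝ)
      (s := Metric.closedBall (0 : Euc N) ‖z‖) (C := 2 * M2 * ‖z‖) (x := 0) (y := z)
      (fun y _ => (hder y).hasFDerivWithinAt) (fun y hy => ?_) (convex_closedBall _ _)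
      (by simp) (by simp)
    · simp only [add_zero, sub_zero, Real.norm_eq_abs] at this
      rw [abs_sub_comm, show φ (x - z) - (2 * φ x - φ (x + z))
        = φ (x + z) + φ (x - z) - (φ x + φ x) by ring]
      exact this.trans (by rw [sq, mul_assoc])
    · rw [mem_closedBall_zero_iff] at hy
      refine (hlip _ _).trans ?_
      have : ‖x + y - (x - y)‖ ≤ 2 * ‖z‖ := by
        rw [show x + y - (x - y) = y + y by abel]
        linarith [norm_add_le y y]
      nlinarith
  have h2 : |2 * φ x - φ (x + z) - φ (x - z)| ≤ 4 * M0 := by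
    have c1 := abs_le.1 (b0 x)
    have c2 := abs_le.1 (b0 (x + z))
    have c3 := abs_le.1 (b0 (x - z))
    rw [abs_le]; constructor <;> linarith
  rcases min_choice (‖z‖ ^ 2) 1 with h | h <;> rw [h]
  · nlinarith [sq_nonneg ‖z‖]
  · linarith

end SecondDifference

section GaussianSchwartz

variable {N : ℕ}

lemma exists_norm_pow_mul_iteratedFDeriv_heat_le {t : ℝ} (ht : 0 < t) (k n : ℕ) :
    ∃ C : ℝ, ∀ x : Euc N, ‖x‖ ^ k * ‖iteratedFDeriv ℝ n (fun z : Euc N => heat t z) x‖ ≤ C := by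
  set A : ℝ := (4 * Real.pi * t) ^ (-(N : ℝ) / 2) with hA
  set f : Euc N → ℝ := fun z => -(1 / (4 * t)) * ‖z‖ ^ 2 with hf
  have hft : Function.HasTemperateGrowth f :=
    (Function.HasTemperateGrowth.const _).mul
      (Function.hasTemperateGrowth_norm_sq _)
  have e : (fun z : Euc N => heat t z) = fun z => A • (Real.exp ∘ f) z := by
    ext z; simp only [heat, hA, hf, Function.comp, smul_eq_mul]; congr 2; ring
  obtain ⟨m, C, hC, hbound⟩ := hft.norm_iteratedFDeriv_le_uniform n
  obtain ⟨C', hC', hw⟩ := heat_le_wt (N := N) (s := (k + m * n + 1 : ℕ)) (by positivity) ht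
  refine ⟨2 ^ (k + m * n) * (n.factorial * (C + 1) ^ n * C'), fun x => ?_⟩
  have h1 : ‖iteratedFDeriv ℝ n (Real.exp ∘ f) x‖
      ≤ n.factorial * Real.exp (f x) * ((C + 1) * (1 + ‖x‖) ^ m) ^ n := by
    refine norm_iteratedFDeriv_comp_le (N := n) Real.contDiff_exp (hft.1.of_le (by exact_mod_cast le_top)) le_rfl x ?_ ?_
    · intro i hi
      rw [norm_iteratedFDeriv_eq_norm_iteratedDeriv, iteratedDeriv_eq_iterate, Real.iter_deriv_exp,
        Real.norm_of_nonneg (Real.exp_pos _).le]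
    · intro i hi1 hi
      have h2 : (1 : ℝ) ≤ (1 + ‖x‖) ^ m := one_le_pow₀ (by linarith [norm_nonneg x])
      refine (hbound i hi x).trans ?_
      calc C * (1 + ‖x‖) ^ m ≤ (C + 1) * (1 + ‖x‖) ^ m := by gcongr; linarith
        _ ≤ _ := le_self_pow₀ (by nlinarith) (by omega)
  have h3 : (1 + ‖x‖) ^ (k + m * n) * heat t x ≤ 2 ^ (k + m * n) * C' := by
    have h4 := hw x
    unfold wt at h4
    rw [mul_one_div, le_div_iff₀ (by positivity)] at h4
    have h5 : (1 + ‖x‖) ^ (k + m * n)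
        ≤ 2 ^ (k + m * n) * (1 + ‖x‖ ^ ((N : ℝ) + 2 * (k + m * n + 1 : ℕ))) := by
      rcases le_total ‖x‖ 1 with h | h
      · calc (1 + ‖x‖) ^ (k + m * n) ≤ (2 : ℝ) ^ (k + m * n) := by gcongr; linarith
          _ ≤ _ := le_mul_of_one_le_right (by positivity) (by
            have : 0 ≤ ‖x‖ ^ ((N : ℝ) + 2 * (k + m * n + 1 : ℕ)) := by positivity
            linarith)
      · calc (1 + ‖x‖) ^ (k + m * n) ≤ (2 * ‖x‖) ^ (k + m * n) := by gcongr; linarith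
          _ = 2 ^ (k + m * n) * ‖x‖ ^ ((k + m * n : ℕ) : ℝ) := by rw [mul_pow, Real.rpow_natCast]
          _ ≤ 2 ^ (k + m * n) * ‖x‖ ^ ((N : ℝ) + 2 * (k + m * n + 1 : ℕ)) := by
            gcongr 2 ^ _ * ?_
            refine Real.rpow_le_rpow_of_exponent_le h ?_
            · push_cast
              have : (0 : ℝ) ≤ N := by positivity
              have : (0 : ℝ) ≤ k := by positivity
              have : (0 : ℝ) ≤ m * n := by positivity
              linarith
          _ ≤ _ := by gcongr; linarith
    have h6 := heat_nonneg ht x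
    calc _ ≤ 2 ^ (k + m * n) * (1 + ‖x‖ ^ ((N : ℝ) + 2 * (k + m * n + 1 : ℕ))) * heat t x := by
          gcongr
      _ = 2 ^ (k + m * n) * (heat t x * (1 + ‖x‖ ^ ((N : ℝ) + 2 * (k + m * n + 1 : ℕ)))) := by
          ring
      _ ≤ _ := by gcongr
  have hcd : ContDiff ℝ n (Real.exp ∘ f) :=
    Real.contDiff_exp.comp (hft.1.of_le (by exact_mod_cast le_top))
  have hA0 : 0 ≤ A := by positivity
  have h7 : A * Real.exp (f x) = heat t x := by
    simpa using (congrFun e x).symm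
  rw [e, iteratedFDeriv_const_smul_apply' hcd.contDiffAt, norm_smul, Real.norm_of_nonneg hA0]
  calc _ ≤ (1 + ‖x‖) ^ k * (A * (n.factorial * Real.exp (f x) * ((C + 1) * (1 + ‖x‖) ^ m) ^ n)) := by
        gcongr
        linarith
    _ = n.factorial * (C + 1) ^ n * ((1 + ‖x‖) ^ (k + m * n) * (A * Real.exp (f x))) := by
        rw [mul_pow, ← pow_mul, pow_add]; ring
    _ ≤ n.factorial * (C + 1) ^ n * (2 ^ (k + m * n) * C') := by rw [h7]; gcongr
    _ = _ := by ring

/-- The heat kernel as a Schwartz function. -/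
noncomputable def heatSchwartz (N : ℕ) {t : ℝ} (ht : 0 < t) : SchwartzMap (Euc N) ℝ where
  toFun z := heat t z
  smooth' := by
    unfold heat
    have : ContDiff ℝ (⊤ : ℕ∞) (fun z : Euc N => ‖z‖ ^ 2) := contDiff_norm_sq ℝ
    exact contDiff_const.mul (Real.contDiff_exp.comp (this.neg.div_const _))
  decay' k n := exists_norm_pow_mul_iteratedFDeriv_heat_le ht k n

lemma heatSchwartz_apply {t : ℝ} (ht : 0 < t) (z : Euc N) : heatSchwartz N ht z = heat t z := rfl

end GaussianSchwartz

section Weak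

variable {N : ℕ}

/-- The fractional Laplacian, without normalising constant, as a second-difference integral. -/
noncomputable def fracLap {N : ℕ} (s : ℝ) (φ : Euc N → ℝ) (x : Euc N) : ℝ :=
  (1 / 2) * ∫ z : Euc N, (2 * φ x - φ (x + z) - φ (x - z)) / ‖z‖ ^ ((N : ℝ) + 2 * s)

lemma integral_heat_secondDiff {τ ρ : ℝ} (hτ : 0 < τ) (hρ : 0 < ρ) (w : Euc N) :
    ∫ z, heat ρ z * ((2 * heat τ w - heat τ (w + z) - heat τ (w - z)) / 2)
      = heat τ w - heat (τ + ρ) w := by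
  have h1 := heat_convolution hτ hρ w
  have i1 := integrable_heat_mul_heat hτ hρ w
  have h2 : ∫ y, heat τ (w + y) * heat ρ y = heat (τ + ρ) w := by
    rw [← h1, ← integral_neg_eq_self]
    simp only [heat_neg, sub_eq_add_neg]
  have i2 : Integrable (fun y => heat τ (w + y) * heat ρ y) := by
    by_contra h
    rw [integral_undef h] at h2
    exact (heat_pos (by positivity) w).ne h2
  have e : ∀ z, heat ρ z * ((2 * heat τ w - heat τ (w + z) - heat τ (w - z)) / 2)
      = heat τ w * heat ρ z - ((1 / 2) * (heat τ (w + z) * heat ρ z)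
        + (1 / 2) * (heat τ (w - z) * heat ρ z)) := fun z => by ring
  simp_rw [e]
  have i3 : Integrable (fun z => (1 / 2) * (heat τ (w + z) * heat ρ z)
      + (1 / 2) * (heat τ (w - z) * heat ρ z)) := (i2.const_mul _).add (i1.const_mul _)
  rw [integral_sub ((integrable_heat hρ).const_mul _) i3, integral_add (i2.const_mul _) (i1.const_mul _),
    integral_const_mul, integral_const_mul, integral_const_mul, integral_heat hρ, h1, h2]
  ring

lemma fracLap_heat (hN : 0 < N) {s : ℝ} (hs : 0 < s) (hs1 : s < 1) {τ : ℝ} (hτ : 0 < τ)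
    (w : Euc N) :
    fracLap s (fun z => heat τ z) w = (subConst N (-s))⁻¹ * heatFrac s τ w := by
  have hN' : (0 : ℝ) < N := by exact_mod_cast hN
  have hsN : -s < (N : ℝ) / 2 := by linarith
  have hK := subConst_pos hsN
  have : Nontrivial (Euc N) := by
    apply Module.nontrivial_of_finrank_pos (R := ℝ); simpa using hN
  have hc := continuous_heat (N := N) τ
  obtain ⟨C, hC, hb⟩ := exists_abs_secondDiff_le (heatSchwartz N hτ)
  simp only [heatSchwartz_apply] at hb
  have hmD : Measurable (fun z => 2 * heat τ w - heat τ (w + z) - heat τ (w - z)) := by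
    have := hc.measurable
    fun_prop
  have hI := integrable_secondDiff_div hN hs hs1 hmD (hb w)
  have e : ∀ z : Euc N, subConst N (-s) * ‖z‖ ^ (2 * -s - (N : ℝ))
      * ((2 * heat τ w - heat τ (w + z) - heat τ (w - z)) / 2)
      = subConst N (-s) / 2 * ((2 * heat τ w - heat τ (w + z) - heat τ (w - z))
        / ‖z‖ ^ ((N : ℝ) + 2 * s)) := by
    intro z
    rw [show 2 * -s - (N : ℝ) = -((N : ℝ) + 2 * s) by ring, Real.rpow_neg (norm_nonneg _)]
    ring
  have hmk : Measurable (Function.uncurry fun (ρ : ℝ) (z : Euc N) => ρ ^ (-s - 1) * heat ρ z) := by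
    have := measurable_heat (N := N)
    simp only [Function.uncurry_def]
    fun_prop
  have S := integral_kernel_swap (μ := volume.restrict (Ioi (0 : ℝ))) (ν := (volume : Measure (Euc N)))
    hmk (h := fun z => (2 * heat τ w - heat τ (w + z) - heat τ (w - z)) / 2)
    (κ := fun z => subConst N (-s) * ‖z‖ ^ (2 * -s - (N : ℝ))) (hmD.div_const _) ?_ ?_ ?_ ?_
  · have S2 := S.2
    simp_rw [e, integral_const_mul, mul_assoc, integral_const_mul] at S2
    have i1 : ∀ ρ ∈ Ioi (0 : ℝ), ρ ^ (-s - 1) * ∫ z : Euc N, heat ρ z *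
        ((2 * heat τ w - heat τ (w + z) - heat τ (w - z)) / 2) = heatDiff s τ ρ w := by
      intro ρ hρ
      rw [integral_heat_secondDiff hτ hρ]; rfl
    rw [setIntegral_congr_fun measurableSet_Ioi i1] at S2
    unfold heatFrac fracLap
    rw [S2]
    field_simp
  · refine ae_of_all _ fun z => ?_
    filter_upwards [ae_restrict_mem measurableSet_Ioi] with ρ hρ
    have hρ : 0 < ρ := hρ
    have := heat_nonneg hρ z
    positivity
  · exact ae_of_all _ fun z => by positivity
  · filter_upwards [compl_mem_ae_iff.2 (measure_singleton (0 : Euc N))] with z hz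
    exact lintegral_rpow_mul_heat hsN hz
  · simp_rw [e]
    exact hI.const_mul _

/-- `u` solves `(-Δ)^s u = f` in the sense of distributions, with `u ≥ 0` in `L_{2s}` and `f ≥ 0`
locally integrable. -/
structure WeakSolution (s : ℝ) (u f : Euc N → ℝ) : Prop where
  measurable_u : Measurable u
  measurable_f : Measurable f
  u_nonneg : ∀ x, 0 ≤ u x
  f_nonneg : ∀ x, 0 ≤ f x
  integrable_u : Integrable (fun y => u y * wt s y)
  locallyIntegrable_f : LocallyIntegrable f
  eq : ∀ φ : SchwartzMap (Euc N) ℝ, ∫ x, u x * fracLap s φ x = ∫ x, f x * φ x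

namespace WeakSolution

variable {s : ℝ} {u f : Euc N → ℝ}

lemma exists_lintegral_ball_le (H : WeakSolution s u f) (hN : 0 < N) (hs : 0 < s) (hs1 : s < 1) :
    ∃ C : ℝ, 0 ≤ C ∧ ∀ R : ℝ, 1 ≤ R →
      ∫⁻ y in Metric.ball (0 : Euc N) R, ENNReal.ofReal (f y)
        ≤ ENNReal.ofReal (C * R ^ ((N : ℝ) + 2 * s)) := by
  obtain ⟨q, hq⟩ : ∃ q : ℝ, q = (N : ℝ) + 2 * s := ⟨_, rfl⟩
  have hq0 : 0 < q := by rw [hq]; positivity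
  rw [← hq]
  let b : ContDiffBump (0 : Euc N) := ⟨1, 2, one_pos, one_lt_two⟩
  obtain ⟨C0, hC0, hb⟩ := exists_abs_secondDiff_le
    (b.hasCompactSupport.toSchwartzMap b.contDiff)
  simp only [HasCompactSupport.toSchwartzMap_toFun] at hb
  obtain ⟨D, hD⟩ : ∃ D : ℝ, D = ∫ z : Euc N, min (‖z‖ ^ 2) 1 / ‖z‖ ^ q := ⟨_, rfl⟩
  have hD0 : 0 ≤ D := hD ▸ integral_nonneg fun z => by positivity
  obtain ⟨K, hK⟩ : ∃ K : ℝ, K = (1 / 2) * (C0 * D) := ⟨_, rfl⟩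
  have hK0 : 0 ≤ K := by rw [hK]; positivity
  obtain ⟨I, hI⟩ : ∃ I : ℝ, I = ∫ y, u y * wt s y := ⟨_, rfl⟩
  have hI0 : 0 ≤ I := hI ▸ integral_nonneg fun y => mul_nonneg (H.u_nonneg y) (wt_pos s y).le
  refine ⟨K * (1 + 2 ^ q) * I, by positivity, fun R hR => ?_⟩
  have hR0 : 0 < R := by linarith
  have hcs : HasCompactSupport (fun y => b (R⁻¹ • y)) := b.hasCompactSupport.comp_smul (by positivity)
  have hcd : ContDiff ℝ (⊤ : ℕ∞) (fun y => b (R⁻¹ • y)) := b.contDiff.comp (contDiff_const_smul _)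
  obtain ⟨χ, hχa⟩ : ∃ χ : SchwartzMap (Euc N) ℝ, ∀ y, χ y = b (R⁻¹ • y) :=
    ⟨hcs.toSchwartzMap hcd, fun y => rfl⟩
  have hcs : HasCompactSupport χ := by
    rwa [show (χ : Euc N → ℝ) = fun y => b (R⁻¹ • y) from funext hχa]
  have hχ0 : ∀ y, 0 ≤ χ y := fun y => (hχa y).symm ▸ b.nonneg
  have hsd : ∀ y z, |2 * χ y - χ (y + z) - χ (y - z)| ≤ C0 * min (‖z‖ ^ 2) 1 := by
    intro y z
    simp only [hχa, smul_add, smul_sub]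
    refine (hb (R⁻¹ • y) (R⁻¹ • z)).trans ?_
    have : ‖R⁻¹ • z‖ ≤ ‖z‖ := by
      rw [norm_smul, Real.norm_of_nonneg (by positivity)]
      exact mul_le_of_le_one_left (norm_nonneg _) (inv_le_one_of_one_le₀ hR)
    gcongr
  have hmχ : Measurable χ := χ.continuous.measurable
  have hLint : ∀ y, Integrable (fun z => (2 * χ y - χ (y + z) - χ (y - z)) / ‖z‖ ^ q) :=
    fun y => by
    rw [hq]; exact integrable_secondDiff_div hN hs hs1 (by fun_prop) (hsd y)
  have hL1 : ∀ y, fracLap s χ y ≤ K := by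
    intro y
    unfold fracLap
    rw [hK, hD, ← hq, ← integral_const_mul C0]
    refine mul_le_mul_of_nonneg_left (integral_mono (hLint y)
      (by rw [hq]; exact (integrable_min_div_rpow hN hs hs1).const_mul _) fun z => ?_) (by norm_num)
    simp only
    rw [← mul_div_assoc]
    gcongr
    exact (le_abs_self _).trans (hsd y z)
  have hL2 : ∀ y, 2 * R ≤ ‖y‖ → fracLap s χ y ≤ 0 := by
    intro y hy
    have h0 : χ y = 0 := by
      rw [hχa]
      apply b.zero_of_le_dist
      rw [dist_zero_right, norm_smul, Real.norm_of_nonneg (by positivity), inv_mul_eq_div,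
        le_div_iff₀ hR0]
      exact hy
    unfold fracLap
    refine mul_nonpos_of_nonneg_of_nonpos (by norm_num) (integral_nonpos fun z => ?_)
    refine div_nonpos_of_nonpos_of_nonneg ?_ (by positivity)
    rw [h0]
    linarith [hχ0 (y + z), hχ0 (y - z)]
  have hpt : ∀ y, u y * fracLap s χ y ≤ K * (1 + 2 ^ q) * R ^ q * (u y * wt s y) := by
    intro y
    have hu := H.u_nonneg y
    have hw := wt_pos s y
    rcases le_total (2 * R) ‖y‖ with h | h
    · exact (mul_nonpos_of_nonneg_of_nonpos hu (hL2 y h)).trans (by positivity)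
    · have h1 : 1 ≤ (1 + 2 ^ q) * R ^ q * wt s y := by
        unfold wt
        rw [← hq, mul_one_div, le_div_iff₀ (by positivity), one_mul]
        have h2 : ‖y‖ ^ q ≤ 2 ^ q * R ^ q := by
          rw [← Real.mul_rpow (by norm_num) hR0.le]; gcongr
        have h3 : 1 ≤ R ^ q := Real.one_le_rpow hR hq0.le
        nlinarith
      calc u y * fracLap s χ y ≤ u y * (K * 1) := by
            rw [mul_one]; gcongr; exact hL1 y
        _ ≤ u y * (K * ((1 + 2 ^ q) * R ^ q * wt s y)) := by gcongr
        _ = _ := by ring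
  have hle : ∫ x, f x * χ x ≤ K * (1 + 2 ^ q) * R ^ q * I := by
    rw [← H.eq χ, hI, ← integral_const_mul]
    by_cases h : Integrable (fun x => u x * fracLap s χ x)
    · exact integral_mono h (H.integrable_u.const_mul _) hpt
    · rw [integral_undef h]
      refine integral_nonneg fun y => ?_
      have := H.u_nonneg y
      have := wt_pos s y
      positivity
  have hfχ : Integrable (fun x => f x * χ x) := by
    have := H.locallyIntegrable_f.integrable_smul_left_of_hasCompactSupport χ.continuous hcs
    simpa [mul_comm] using this
  calc ∫⁻ y in Metric.ball (0 : Euc N) R, ENNReal.ofReal (f y)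
      ≤ ∫⁻ y in Metric.ball (0 : Euc N) R, ENNReal.ofReal (f y * χ y) := by
        refine setLIntegral_mono' measurableSet_ball fun y hy => ENNReal.ofReal_le_ofReal ?_
        have : χ y = 1 := by
          rw [hχa]
          apply b.one_of_mem_closedBall
          rw [mem_closedBall_zero_iff, norm_smul, Real.norm_of_nonneg (by positivity),
            inv_mul_eq_div, div_le_iff₀ hR0]
          have := (mem_ball_zero_iff.1 hy).le
          simpa [b] using this
        rw [this, mul_one]
    _ ≤ ∫⁻ y, ENNReal.ofReal (f y * χ y) := setLIntegral_le_lintegral _ _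
    _ = ENNReal.ofReal (∫ y, f y * χ y) :=
        (ofReal_integral_eq_lintegral_ofReal hfχ
          (ae_of_all _ fun y => mul_nonneg (H.f_nonneg y) (hχ0 y))).symm
    _ ≤ _ := ENNReal.ofReal_le_ofReal (hle.trans (le_of_eq (by ring)))

lemma integrable_mul_wt (H : WeakSolution s u f) (hN : 0 < N) (hs : 0 < s) (hs1 : s < 1) :
    Integrable (fun y => f y * wt (s + 1) y) := by
  obtain ⟨C, hC, hball⟩ := H.exists_lintegral_ball_le hN hs hs1
  set q : ℝ := (N : ℝ) + 2 * (s + 1) with hq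
  have hq0 : 0 < q := by positivity
  have hf := H.measurable_f
  have hw := measurable_wt (N := N) (s + 1)
  have hpt : ∀ y : Euc N, ENNReal.ofReal (wt (s + 1) y)
      ≤ ∫⁻ R in Ioi (1 : ℝ), (if ‖y‖ < R then ENNReal.ofReal (q * R ^ (-q - 1)) else 0) := by
    intro y
    set m := max 1 ‖y‖ with hm
    have hm0 : 0 < m := one_pos.trans_le (le_max_left _ _)
    calc ENNReal.ofReal (wt (s + 1) y) ≤ ENNReal.ofReal (m ^ (-q)) := by
          apply ENNReal.ofReal_le_ofReal
          unfold wt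
          rw [← hq, Real.rpow_neg hm0.le, one_div]
          gcongr
          rcases max_choice 1 ‖y‖ with h | h <;> rw [hm, h]
          · rw [Real.one_rpow]
            have : 0 ≤ ‖y‖ ^ q := by positivity
            linarith
          · linarith
      _ = ENNReal.ofReal (∫ R in Ioi m, q * R ^ (-q - 1)) := by
          rw [integral_const_mul, integral_Ioi_rpow_of_lt (by linarith) hm0,
            show -q - 1 + 1 = -q by ring, neg_div_neg_eq]
          congr 1; field_simp
      _ = ∫⁻ R in Ioi m, ENNReal.ofReal (q * R ^ (-q - 1)) := by
          rw [ofReal_integral_eq_lintegral_ofReal]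
          · exact (integrableOn_Ioi_rpow_of_lt (by linarith) hm0).const_mul _
          · filter_upwards [ae_restrict_mem measurableSet_Ioi] with ρ hρ
            have hρ : 0 < ρ := hm0.trans hρ
            positivity
      _ = ∫⁻ R in Ioi m, (if ‖y‖ < R then ENNReal.ofReal (q * R ^ (-q - 1)) else 0) := by
          refine setLIntegral_congr_fun measurableSet_Ioi fun R hR => ?_
          rw [if_pos ((le_max_right _ _).trans_lt hR)]
      _ ≤ _ := lintegral_mono_set (Ioi_subset_Ioi (le_max_left _ _))
  refine ⟨(hf.mul hw).aestronglyMeasurable, ?_⟩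
  rw [hasFiniteIntegral_iff_ofReal
    (ae_of_all _ fun y => mul_nonneg (H.f_nonneg y) (wt_pos _ y).le)]
  have hmeas : Measurable (fun p : Euc N × ℝ => ENNReal.ofReal (f p.1) *
      (if ‖p.1‖ < p.2 then ENNReal.ofReal (q * p.2 ^ (-q - 1)) else 0)) := by
    refine Measurable.mul (by fun_prop) (Measurable.ite ?_ (by fun_prop) (by fun_prop))
    exact measurableSet_lt (by fun_prop) (by fun_prop)
  calc ∫⁻ y, ENNReal.ofReal (f y * wt (s + 1) y)
      ≤ ∫⁻ y, ∫⁻ R in Ioi (1 : ℝ), ENNReal.ofReal (f y) *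
          (if ‖y‖ < R then ENNReal.ofReal (q * R ^ (-q - 1)) else 0) := by
        refine lintegral_mono fun y => ?_
        simp only
        rw [ENNReal.ofReal_mul (H.f_nonneg y), lintegral_const_mul' _ _ ENNReal.ofReal_ne_top]
        gcongr
        exact hpt y
    _ = ∫⁻ R in Ioi (1 : ℝ), ∫⁻ y, ENNReal.ofReal (f y) *
          (if ‖y‖ < R then ENNReal.ofReal (q * R ^ (-q - 1)) else 0) :=
        lintegral_lintegral_swap hmeas.aemeasurable
    _ ≤ ∫⁻ R in Ioi (1 : ℝ), ENNReal.ofReal (C * q * R ^ (-3 : ℝ)) := by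
        refine setLIntegral_mono' measurableSet_Ioi fun R hR => ?_
        have hR1 : 1 < R := hR
        have hR0 : 0 < R := one_pos.trans hR1
        have e : ∀ y : Euc N, ENNReal.ofReal (f y) *
            (if ‖y‖ < R then ENNReal.ofReal (q * R ^ (-q - 1)) else 0)
            = (Metric.ball (0 : Euc N) R).indicator (fun y => ENNReal.ofReal (f y)) y
              * ENNReal.ofReal (q * R ^ (-q - 1)) := by
          intro y
          simp only [indicator, mem_ball_zero_iff]
          split_ifs <;> simp
        simp_rw [e]
        rw [lintegral_mul_const' _ _ ENNReal.ofReal_ne_top, lintegral_indicator measurableSet_ball]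
        calc _ ≤ ENNReal.ofReal (C * R ^ ((N : ℝ) + 2 * s)) * ENNReal.ofReal (q * R ^ (-q - 1)) := by
              gcongr; exact hball R hR1.le
          _ = _ := by
              rw [← ENNReal.ofReal_mul (by positivity)]
              have e3 : R ^ ((N : ℝ) + 2 * s) * R ^ (-q - 1) = R ^ (-3 : ℝ) := by
                rw [← Real.rpow_add hR0]; congr 1; rw [hq]; ring
              rw [← e3]
              congr 1
              ring
    _ = ENNReal.ofReal (∫ R in Ioi (1 : ℝ), C * q * R ^ (-3 : ℝ)) := by
        rw [ofReal_integral_eq_lintegral_ofReal]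
        · exact (integrableOn_Ioi_rpow_of_lt (by norm_num) one_pos).const_mul _
        · filter_upwards [ae_restrict_mem measurableSet_Ioi] with ρ hρ
          have hρ : 0 < ρ := one_pos.trans hρ
          positivity
    _ < ⊤ := ENNReal.ofReal_lt_top

end WeakSolution

/-- Translated heat kernels are dominated by the weight, locally uniformly in time. -/
lemma exists_heat_sub_le_wt {s : ℝ} (hs : 0 < s) {τ : ℝ} (hτ : 0 < τ) (x : Euc N) :
    ∃ C : ℝ, 0 ≤ C ∧ ∀ y, heat τ (x - y) ≤ C * wt s y := by
  obtain ⟨C1, h1, h2⟩ := heat_le_wt (N := N) hs hτ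
  obtain ⟨C2, h3, h4⟩ := wt_translate hs x
  refine ⟨C1 * C2, by positivity, fun y => (h2 (x - y)).trans ?_⟩
  rw [mul_assoc]
  gcongr
  exact h4 y

lemma integrable_mul_heat {s : ℝ} (hs : 0 < s) {g : Euc N → ℝ} (hg : Measurable g)
    (hgi : Integrable (fun y => g y * wt s y)) {τ : ℝ} (hτ : 0 < τ) (x : Euc N) :
    Integrable (fun y => g y * heat τ (x - y)) := by
  obtain ⟨C, hC, h⟩ := exists_heat_sub_le_wt hs hτ x
  have := (continuous_heat (N := N) τ).measurable
  refine Integrable.mono' (hgi.norm.const_mul C)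
    (hg.mul (this.comp (measurable_const.sub measurable_id))).aestronglyMeasurable
    (ae_of_all _ fun y => ?_)
  rw [norm_mul, norm_mul, Real.norm_of_nonneg (heat_nonneg hτ _),
    Real.norm_of_nonneg (wt_pos s y).le]
  calc _ ≤ ‖g y‖ * (C * wt s y) := by gcongr; exact h y
    _ = _ := by ring

namespace WeakSolution

variable {s : ℝ} {u f : Euc N → ℝ}

lemma integrable_f_mul_heat (H : WeakSolution s u f) (hN : 0 < N) (hs : 0 < s) (hs1 : s < 1)
    {τ : ℝ} (hτ : 0 < τ) (x : Euc N) : Integrable (fun y => f y * heat τ (x - y)) :=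
  integrable_mul_heat (by linarith) H.measurable_f (H.integrable_mul_wt hN hs hs1) hτ x

lemma integrable_u_mul_heat (H : WeakSolution s u f) (hs : 0 < s)
    {τ : ℝ} (hτ : 0 < τ) (x : Euc N) : Integrable (fun y => u y * heat τ (x - y)) :=
  integrable_mul_heat hs H.measurable_u H.integrable_u hτ x

/-- Testing the equation with a heat kernel. -/
lemma integral_f_mul_heat (H : WeakSolution s u f) (hN : 0 < N) (hs : 0 < s) (hs1 : s < 1)
    {τ : ℝ} (hτ : 0 < τ) (x : Euc N) :
    ∫ y, f y * heat τ (x - y) = (subConst N (-s))⁻¹ * ∫ y, u y * heatFrac s τ (x - y) := by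
  set φ := SchwartzMap.compSubConstCLM ℝ x (heatSchwartz N hτ) with hφ
  have hφa : ∀ y, φ y = heat τ (y - x) := fun y => rfl
  have h := H.eq φ
  have e : ∀ y, fracLap s φ y = (subConst N (-s))⁻¹ * heatFrac s τ (x - y) := by
    intro y
    rw [← fracLap_heat hN hs hs1 hτ]
    unfold fracLap
    simp only [hφa]
    congr 1
    refine integral_congr_ae (ae_of_all _ fun z => ?_)
    simp only
    rw [heat_sub_comm τ y x, heat_sub_comm τ (y + z) x, heat_sub_comm τ (y - z) x,
      show x - (y + z) = x - y - z by abel, show x - (y - z) = x - y + z by abel]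
    ring
  simp only [e, hφa] at h
  rw [← integral_const_mul]
  simp only [heat_sub_comm τ _ x] at h
  rw [← h]
  congr 1; ext y; ring

end WeakSolution

end Weak

section HeatFlow

variable {N : ℕ} {s : ℝ} {u f : Euc N → ℝ}

namespace WeakSolution

lemma integrable_rpow_mul_heatFrac (H : WeakSolution s u f) (hs : 0 < s) (hs1 : s < 1)
    {t R : ℝ} (ht : 0 < t) (hR : 0 < R) (x : Euc N) :
    Integrable (fun p : Euc N × ℝ => u p.1 * (p.2 ^ (s - 1) * heatFrac s (t + p.2) (x - p.1)))
      (volume.prod (volume.restrict (Ioo 0 R))) := by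
  obtain ⟨C, hC, hb⟩ := abs_heatFrac_le (N := N) hs hs1 ht (show t ≤ t + R by linarith)
  obtain ⟨C2, hC2, hb2⟩ := wt_translate (N := N) hs x
  have hi : IntegrableOn (fun r : ℝ => r ^ (s - 1)) (Ioo 0 R) :=
    (intervalIntegral.integrableOn_Ioo_rpow_iff hR).2 (by linarith)
  have hmu := H.measurable_u
  have hm := measurable_heatFrac (N := N) s
  have hm' : Measurable (fun p : Euc N × ℝ => heatFrac s (t + p.2) (x - p.1)) :=
    hm.comp (by fun_prop : Measurable (fun p : Euc N × ℝ => (t + p.2, x - p.1)))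
  refine Integrable.mono' ((H.integrable_u.mul_prod hi).const_mul (C * C2))
    (by fun_prop) ?_
  have : ∀ᵐ p ∂((volume : Measure (Euc N)).prod (volume.restrict (Ioo (0 : ℝ) R))),
      p.2 ∈ Ioo 0 R :=
    Measure.quasiMeasurePreserving_snd.ae (ae_restrict_mem measurableSet_Ioo)
  filter_upwards [this] with p hp
  have hu := H.u_nonneg p.1
  have hr := hp.1
  rw [norm_mul, norm_mul, Real.norm_of_nonneg hu, Real.norm_of_nonneg (by positivity),
    Real.norm_eq_abs]
  have h1 := hb (t + p.2) ⟨by linarith [hp.1], by linarith [hp.2]⟩ (x - p.1)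
  calc _ ≤ u p.1 * (p.2 ^ (s - 1) * (C * (C2 * wt s p.1))) := by
        gcongr
        exact h1.trans (by gcongr; exact hb2 p.1)
    _ = _ := by ring

/-- Duhamel-type identity for the heat flow of a weak solution. -/
lemma integral_rpow_mul_heat_f (H : WeakSolution s u f) (hN : 0 < N) (hs : 0 < s) (hs1 : s < 1)
    {t R : ℝ} (ht : 0 < t) (hR : 0 < R) (x : Euc N) :
    IntegrableOn (fun r => r ^ (s - 1) * ∫ y, f y * heat (t + r) (x - y)) (Ioo 0 R) ∧
    Integrable (fun y => u y * heatMean s t R (x - y)) ∧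
    ∫ r in Ioo 0 R, r ^ (s - 1) * ∫ y, f y * heat (t + r) (x - y)
      = (subConst N (-s))⁻¹ / s * (betaMass s * (∫ y, u y * heat t (x - y))
        - ∫ y, u y * heatMean s t R (x - y)) := by
  have hG := H.integrable_rpow_mul_heatFrac hs hs1 ht hR x
  have hU := H.integrable_u_mul_heat hs ht x
  have hB := betaMass_pos hs hs1
  have e1 : ∀ r ∈ Ioo (0 : ℝ) R, r ^ (s - 1) * ∫ y, f y * heat (t + r) (x - y)
      = (subConst N (-s))⁻¹ * ∫ y, u y * (r ^ (s - 1) * heatFrac s (t + r) (x - y)) := by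
    intro r hr
    rw [H.integral_f_mul_heat hN hs hs1 (by linarith [hr.1])]
    simp_rw [mul_left_comm (u _), integral_const_mul]
    ring
  have e2 : ∀ y, ∫ r in Ioo 0 R, u y * (r ^ (s - 1) * heatFrac s (t + r) (x - y))
      = (1 / s) * (betaMass s * (u y * heat t (x - y)) - u y * heatMean s t R (x - y)) := by
    intro y
    rw [integral_const_mul, integral_rpow_mul_heatFrac hN hs hs1 ht hR]
    ring
  have hI1 := hG.integral_prod_left
  have hI2 := hG.integral_prod_right
  simp only [e2] at hI1
  have hM : Integrable (fun y => u y * heatMean s t R (x - y)) := by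
    have := (hU.const_mul (betaMass s)).sub (hI1.const_mul s)
    refine this.congr (ae_of_all _ fun y => ?_)
    simp only [Pi.sub_apply]
    field_simp
    ring
  refine ⟨?_, hM, ?_⟩
  · refine IntegrableOn.congr_fun (hI2.const_mul (subConst N (-s))⁻¹) (fun r hr => ?_)
      measurableSet_Ioo
    exact (e1 r hr).symm
  · rw [setIntegral_congr_fun measurableSet_Ioo e1, integral_const_mul,
      ← integral_integral_swap (f := fun y r => u y * (r ^ (s - 1) * heatFrac s (t + r) (x - y))) hG]
    simp_rw [e2]
    rw [integral_const_mul, integral_sub (hU.const_mul _) hM, integral_const_mul]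
    ring

lemma integral_u_mul_heatMean_nonneg (H : WeakSolution s u f) {t R : ℝ} (ht : 0 < t) (hR : 0 < R)
    (x : Euc N) : 0 ≤ ∫ y, u y * heatMean s t R (x - y) :=
  integral_nonneg fun y => mul_nonneg (H.u_nonneg y) (heatMean_nonneg s ht hR _)

lemma integral_f_mul_heat_nonneg (H : WeakSolution s u f) {t : ℝ} (ht : 0 < t)
    (x : Euc N) : 0 ≤ ∫ y, f y * heat t (x - y) :=
  integral_nonneg fun y => mul_nonneg (H.f_nonneg y) (heat_nonneg ht _)

lemma integral_u_mul_heatMean_le (H : WeakSolution s u f) (hN : 0 < N) (hs : 0 < s) (hs1 : s < 1)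
    {t R : ℝ} (ht : 0 < t) (hR : 0 < R) (x : Euc N) :
    ∫ y, u y * heatMean s t R (x - y) ≤ betaMass s * ∫ y, u y * heat t (x - y) := by
  have hK := subConst_pos (N := N) (a := -s) (by linarith [(Nat.cast_nonneg N : (0 : ℝ) ≤ N)])
  have h := (H.integral_rpow_mul_heat_f hN hs hs1 ht hR x).2.2
  have h0 : 0 ≤ ∫ r in Ioo 0 R, r ^ (s - 1) * ∫ y, f y * heat (t + r) (x - y) := by
    refine setIntegral_nonneg measurableSet_Ioo fun r hr => ?_
    have := hr.1
    have := H.integral_f_mul_heat_nonneg (show 0 < t + r by positivity) x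
    positivity
  rw [h] at h0
  have := nonneg_of_mul_nonneg_right h0 (by positivity)
  linarith

lemma integral_rpow_mul_heat_f_le (H : WeakSolution s u f) (hN : 0 < N) (hs : 0 < s) (hs1 : s < 1)
    {t R : ℝ} (ht : 0 < t) (hR : 0 < R) (x : Euc N) :
    ∫ r in Ioo 0 R, r ^ (s - 1) * ∫ y, f y * heat (t + r) (x - y)
      ≤ (subConst N (-s))⁻¹ / s * (betaMass s * (∫ y, u y * heat t (x - y))) := by
  have hK := subConst_pos (N := N) (a := -s) (by linarith [(Nat.cast_nonneg N : (0 : ℝ) ≤ N)])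
  rw [(H.integral_rpow_mul_heat_f hN hs hs1 ht hR x).2.2]
  gcongr
  linarith [H.integral_u_mul_heatMean_nonneg ht hR x]

lemma integral_u_mul_heatMean_harnack (H : WeakSolution s u f) (hN : 0 < N) (hs : 0 < s)
    (hs1 : s < 1) {t t' R : ℝ} {x x' : Euc N} (ht : 0 < t) (ht' : 0 < t') (hR : 3 * t ≤ R)
    (hR' : t' ≤ R) (hx : ‖x - x'‖ ^ 2 ≤ R) :
    ∫ y, u y * heatMean s t R (x - y)
      ≤ (3 : ℝ) ^ ((N : ℝ) / 2) * Real.exp (1 / 2) *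
        ∫ y, u y * heatMean s t' (2 * R) (x' - y) := by
  have hR0 : 0 < R := by linarith
  rw [← integral_const_mul]
  refine integral_mono (H.integral_rpow_mul_heat_f hN hs hs1 ht hR0 x).2.1
    ((H.integral_rpow_mul_heat_f hN hs hs1 ht' (by positivity) x').2.1.const_mul _) fun y => ?_
  simp only
  rw [mul_left_comm]
  refine mul_le_mul_of_nonneg_left ?_ (H.u_nonneg y)
  unfold heatMean
  rw [← integral_const_mul]
  refine setIntegral_mono_on (integrableOn_betaFun_mul_heat hs hs1 ht hR0 _)
    ((integrableOn_betaFun_mul_heat hs hs1 ht' (by positivity) _).const_mul _)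
    measurableSet_Ioo fun w hw => ?_
  have hw0 := hw.1
  have hRw : R ≤ R / w := by
    rw [le_div_iff₀ hw0]; nlinarith [hw.2]
  have h2 : 2 * R / w = 2 * (R / w) := by ring
  rw [mul_left_comm]
  refine mul_le_mul_of_nonneg_left ?_ (betaFun_pos s hw).le
  apply heat_harnack <;> first | (rw [h2]; linarith) | linarith

end WeakSolution

end HeatFlow

section Positivity

variable {N : ℕ}

lemma integral_mul_heat_sub_eq (φ : Euc N → ℝ) {t : ℝ} (ht : 0 < t) (y : Euc N) :
    ∫ x, φ x * heat t (x - y) = ∫ z, φ (y + √t • z) * heat 1 z := by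
  have hst : 0 < √t := Real.sqrt_pos.2 ht
  have h1 := integral_add_left_eq_self (μ := volume) (fun x => φ x * heat t (x - y)) y
  have h2 := Measure.integral_comp_smul volume (fun x : Euc N => φ (y + x) * heat t x) (√t)
  have e1 : ((√t) ^ N)⁻¹ = t ^ (-(N : ℝ) / 2) := by
    rw [Real.sqrt_eq_rpow, ← Real.rpow_natCast, ← Real.rpow_mul ht.le, ← Real.rpow_neg ht.le]
    congr 1; ring
  have e2 : ∀ z : Euc N, heat t (√t • z) = t ^ (-(N : ℝ) / 2) * heat 1 z := by
    intro z
    have := heat_scale (N := N) ht one_pos (√t • z)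
    rw [mul_one] at this
    rw [this, smul_smul, Real.sqrt_eq_rpow, ← Real.rpow_add ht]
    norm_num
  have hp : 0 < t ^ (-(N : ℝ) / 2) := by positivity
  simp only [add_sub_cancel_left] at h1
  rw [← h1]
  simp only [finrank_euclideanSpace, Fintype.card_fin, e1, e2, abs_of_pos hp, smul_eq_mul,
    mul_left_comm (φ _), integral_const_mul] at h2
  exact (mul_left_cancel₀ hp.ne' h2).symm

lemma tendsto_integral_mul_heat_sub {φ : Euc N → ℝ} (hφ : Continuous φ) {C : ℝ}
    (hC : ∀ x, ‖φ x‖ ≤ C) (y : Euc N) :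
    Tendsto (fun t => ∫ x, φ x * heat t (x - y)) (nhdsWithin 0 (Ioi 0)) (nhds (φ y)) := by
  have h : Tendsto (fun t => ∫ z : Euc N, φ (y + √t • z) * heat 1 z) (nhdsWithin 0 (Ioi 0))
      (nhds (∫ z : Euc N, φ y * heat 1 z)) := by
    refine tendsto_integral_filter_of_dominated_convergence (fun z => C * heat 1 z) ?_ ?_
      ((integrable_heat one_pos).const_mul C) ?_
    · have := continuous_heat (N := N) 1
      exact Eventually.of_forall fun t => Continuous.aestronglyMeasurable (by fun_prop)
    · refine Eventually.of_forall fun t => ae_of_all _ fun z => ?_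
      have := heat_nonneg one_pos z
      rw [norm_mul, Real.norm_of_nonneg this]
      gcongr
      exact hC _
    · refine ae_of_all _ fun z => ?_
      refine Tendsto.mul_const _ ((Continuous.tendsto' ?_ _ _ ?_).mono_left nhdsWithin_le_nhds)
      · fun_prop
      · simp
  rw [integral_const_mul, integral_heat one_pos, mul_one] at h
  refine h.congr' ?_
  filter_upwards [self_mem_nhdsWithin] with t ht
  exact (integral_mul_heat_sub_eq φ ht y).symm

lemma locallyIntegrable_of_mul_heat {v : Euc N → ℝ}
    (hvi : Integrable (fun y => v y * heat 1 y)) : LocallyIntegrable v := by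
  have hpos : ∀ y : Euc N, heat 1 y ≠ 0 := fun y => (heat_pos one_pos y).ne'
  have hc : Continuous (fun y : Euc N => (heat 1 y)⁻¹) := (continuous_heat 1).inv₀ hpos
  have h2 := (hvi.locallyIntegrable.locallyIntegrableOn univ).continuousOn_mul hc.continuousOn
    isOpen_univ.isLocallyClosed
  rw [locallyIntegrableOn_univ] at h2
  refine (locallyIntegrable_congr (ae_of_all _ fun y => ?_)).1 h2
  have := hpos y
  field_simp

lemma integral_mul_nonneg_of_heat {v φ : Euc N → ℝ} (hv : Measurable v)
    (hvi : Integrable (fun y => v y * heat 1 y))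
    (h : ∀ x, ∀ t > 0, 0 ≤ ∫ y, v y * heat t (x - y))
    (hφ : Continuous φ) (hφc : HasCompactSupport φ) (hφ0 : ∀ x, 0 ≤ φ x) :
    0 ≤ ∫ y, φ y * v y := by
  have hheat := continuous_heat (N := N) (1 / 2)
  have hpos : ∀ x : Euc N, 0 < heat (1 / 2) x := heat_pos (by norm_num)
  obtain ⟨C, hC⟩ : ∃ C, ∀ x, ‖φ x / heat (1 / 2) x‖ ≤ C := by
    refine Continuous.bounded_above_of_compact_support
      (hφ.div hheat fun x => (hpos x).ne') ?_
    simp_rw [div_eq_mul_inv]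
    exact hφc.mul_right
  have hC0 : 0 ≤ C := (norm_nonneg _).trans (hC 0)
  have hφC : ∀ x, φ x ≤ C * heat (1 / 2) x := by
    intro x
    have := (le_abs_self _).trans (hC x)
    rwa [div_le_iff₀ (hpos x)] at this
  obtain ⟨C1, hC1, hw⟩ : ∃ C1 : ℝ, 0 ≤ C1 ∧ ∀ τ ∈ Icc (1 / 2 : ℝ) 1, ∀ z : Euc N,
      heat τ z ≤ C1 * heat 1 z :=
    ⟨(2 : ℝ) ^ ((N : ℝ) / 2), by positivity, fun τ hτ z =>
      heat_le_heat_of_ratio (by linarith [hτ.1]) hτ.2 (by linarith [hτ.1]) z⟩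
  obtain ⟨C2, hC2⟩ := hφ.bounded_above_of_compact_support hφc
  have hint : ∀ t > 0, ∀ y, Integrable (fun x => φ x * heat t (x - y)) := by
    intro t ht y
    have := continuous_heat (N := N) t
    exact Continuous.integrable_of_hasCompactSupport (by fun_prop) hφc.mul_right
  have hbd : ∀ t ∈ Ioo (0 : ℝ) (1 / 2), ∀ y, 0 ≤ ∫ x, φ x * heat t (x - y) ∧
      ∫ x, φ x * heat t (x - y) ≤ C * C1 * heat 1 y := by
    intro t ht y
    refine ⟨integral_nonneg fun x => mul_nonneg (hφ0 x) (heat_nonneg ht.1 _), ?_⟩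
    have e := heat_convolution (N := N) ht.1 (show (0 : ℝ) < 1 / 2 by norm_num) y
    calc ∫ x, φ x * heat t (x - y) ≤ ∫ x, C * (heat t (y - x) * heat (1 / 2) x) := by
          refine integral_mono (hint t ht.1 y)
            ((integrable_heat_mul_heat ht.1 (by norm_num) y).const_mul C) fun x => ?_
          simp only
          rw [heat_sub_comm t y x]
          have := heat_nonneg ht.1 (x - y)
          calc _ ≤ C * heat (1 / 2) x * heat t (x - y) := by gcongr; exact hφC x
            _ = _ := by ring
      _ = C * heat (t + 1 / 2) y := by rw [integral_const_mul, e]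
      _ ≤ C * (C1 * heat 1 y) := by
          gcongr; exact hw _ ⟨by linarith [ht.1], by linarith [ht.2]⟩ y
      _ = _ := by ring
  have hmk : ∀ t, Measurable (Function.uncurry fun x y : Euc N => φ x * heat t (x - y)) := by
    intro t
    have := continuous_heat (N := N) t
    simp only [Function.uncurry_def]
    exact Continuous.measurable (by fun_prop)
  have hmκ : ∀ t, AEStronglyMeasurable (fun y => ∫ x, φ x * heat t (x - y)) volume := by
    intro t
    exact ((hmk t).stronglyMeasurable.integral_prod_left
      (μ := (volume : Measure (Euc N)))).aestronglyMeasurable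
  have hpt : ∀ t ∈ Ioo (0 : ℝ) (1 / 2), ∀ y, ‖(∫ x, φ x * heat t (x - y)) * v y‖
      ≤ C * C1 * ‖v y * heat 1 y‖ := by
    intro t ht y
    have hb := hbd t ht y
    rw [norm_mul, norm_mul, Real.norm_of_nonneg hb.1, Real.norm_of_nonneg (heat_pos one_pos y).le]
    calc _ ≤ C * C1 * heat 1 y * ‖v y‖ := by gcongr; exact hb.2
      _ = _ := by ring
  have hev : ∀ᶠ t in nhdsWithin (0 : ℝ) (Ioi 0), t ∈ Ioo (0 : ℝ) (1 / 2) :=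
    Ioo_mem_nhdsGT (by norm_num)
  have hlim : Tendsto (fun t => ∫ y, (∫ x, φ x * heat t (x - y)) * v y)
      (nhdsWithin 0 (Ioi 0)) (nhds (∫ y, φ y * v y)) := by
    refine tendsto_integral_filter_of_dominated_convergence
      (fun y => C * C1 * ‖v y * heat 1 y‖) ?_ ?_ (hvi.norm.const_mul _) ?_
    · exact Eventually.of_forall fun t => (hmκ t).mul hv.aestronglyMeasurable
    · filter_upwards [hev] with t ht
      exact ae_of_all _ (hpt t ht)
    · exact ae_of_all _ fun y => (tendsto_integral_mul_heat_sub hφ hC2 y).mul_const _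
  refine ge_of_tendsto hlim ?_
  filter_upwards [hev] with t ht
  have S := integral_kernel_swap (μ := (volume : Measure (Euc N)))
    (ν := (volume : Measure (Euc N))) (hmk t) (h := v)
    (κ := fun y => ∫ x, φ x * heat t (x - y)) hv ?_ ?_ ?_ ?_
  · rw [← S.2]
    refine integral_nonneg fun x => ?_
    simp_rw [mul_assoc, integral_const_mul, mul_comm (heat t _)]
    exact mul_nonneg (hφ0 x) (h x t ht.1)
  · exact ae_of_all _ fun y => ae_of_all _ fun x => mul_nonneg (hφ0 x) (heat_nonneg ht.1 _)
  · exact ae_of_all _ fun y => (hbd t ht y).1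
  · exact ae_of_all _ fun y => (ofReal_integral_eq_lintegral_ofReal (hint t ht.1 y)
      (ae_of_all _ fun x => mul_nonneg (hφ0 x) (heat_nonneg ht.1 _))).symm
  · exact Integrable.mono' (hvi.norm.const_mul (C * C1)) ((hmκ t).mul hv.aestronglyMeasurable)
      (ae_of_all _ (hpt t ht))

/-- A Gaussian-integrable function with nonnegative heat extension is nonnegative. -/
lemma ae_nonneg_of_heat {v : Euc N → ℝ} (hv : Measurable v)
    (hvi : Integrable (fun y => v y * heat 1 y))
    (h : ∀ x, ∀ t > 0, 0 ≤ ∫ y, v y * heat t (x - y)) : ∀ᵐ x, 0 ≤ v x := by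
  let φ : ℕ → ContDiffBump (0 : Euc N) := fun n =>
    ⟨1 / (n + 1), 2 * (1 / (n + 1)), by positivity, by
      have : (0 : ℝ) < 1 / (n + 1) := by positivity
      linarith⟩
  have h1 : Tendsto (fun n => (φ n).rOut) atTop (nhds 0) := by
    have := (tendsto_one_div_add_atTop_nhds_zero_nat (𝕜 := ℝ)).const_mul 2
    rwa [mul_zero] at this
  have h2 : ∀ᶠ n in atTop, (φ n).rOut ≤ 2 * (φ n).rIn := Eventually.of_forall fun n => le_rfl
  filter_upwards [ContDiffBump.ae_convolution_tendsto_right_of_locallyIntegrable (μ := volume)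
    h1 h2 (locallyIntegrable_of_mul_heat hvi)] with x hx
  refine ge_of_tendsto' hx fun n => ?_
  rw [convolution_eq_swap]
  simp only [ContinuousLinearMap.lsmul_apply, smul_eq_mul]
  refine integral_mul_nonneg_of_heat hv hvi h
    ((φ n).continuous_normed.comp (continuous_const.sub continuous_id)) ?_
    fun y => (φ n).nonneg_normed _
  exact (φ n).hasCompactSupport_normed.comp_homeomorph (Homeomorph.subLeft x)

end Positivity

section Vanishing

variable {N : ℕ} {s : ℝ} {u f : Euc N → ℝ}

namespace WeakSolution

lemma rpow_mul_le_integral_f_mul_heat (H : WeakSolution s u f) (hN : 0 < N) (hs : 0 < s)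
    (hs1 : s < 1) {α c : ℝ} (hc : 0 < c) (hf : ∀ᵐ y : Euc N, c * ‖y‖ ^ α ≤ f y) :
    ∃ G : ℝ, 0 < G ∧ ∀ τ > 0, G * τ ^ (α / 2) ≤ ∫ y, f y * heat τ (0 - y) := by
  have : Nontrivial (Euc N) := by
    apply Module.nontrivial_of_finrank_pos (R := ℝ); simpa using hN
  have hm : Measurable (fun y : Euc N => ‖y‖ ^ α * heat 1 y) := by
    have := (continuous_heat (N := N) 1).measurable
    fun_prop
  have hh : ∀ y : Euc N, 0 < heat 1 y := heat_pos one_pos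
  have hle : ∀ τ > 0, ∀ᵐ y : Euc N, c * (‖y‖ ^ α * heat τ y) ≤ f y * heat τ (0 - y) := by
    intro τ hτ
    filter_upwards [hf] with y hy
    have := heat_nonneg hτ y
    rw [zero_sub, heat_neg, ← mul_assoc]
    gcongr
  have hi : Integrable (fun y : Euc N => ‖y‖ ^ α * heat 1 y) := by
    refine Integrable.mono' ((H.integrable_f_mul_heat hN hs hs1 one_pos 0).const_mul c⁻¹)
      hm.aestronglyMeasurable ?_
    filter_upwards [hle 1 one_pos] with y hy
    have := hh y
    rw [Real.norm_of_nonneg (by positivity), inv_mul_eq_div, le_div_iff₀ hc]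
    linarith
  have hpos : 0 < ∫ y : Euc N, ‖y‖ ^ α * heat 1 y := by
    rw [integral_pos_iff_support_of_nonneg (fun y => by have := hh y; positivity) hi]
    have hsub : ({0} : Set (Euc N))ᶜ ⊆ Function.support (fun y : Euc N => ‖y‖ ^ α * heat 1 y) := by
      intro y hy
      have h0 : 0 < ‖y‖ := norm_pos_iff.2 hy
      have := hh y
      exact (by positivity : ‖y‖ ^ α * heat 1 y ≠ 0)
    refine lt_of_lt_of_le ?_ (measure_mono hsub)
    rw [measure_compl (measurableSet_singleton _) (by simp)]
    simp
  refine ⟨c * ∫ y : Euc N, ‖y‖ ^ α * heat 1 y, by positivity, fun τ hτ => ?_⟩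
  have e := integral_mul_heat_sub_eq (fun y : Euc N => ‖y‖ ^ α) hτ 0
  simp only [sub_zero, zero_add, norm_smul, Real.norm_of_nonneg (Real.sqrt_nonneg τ)] at e
  have e2 : (√τ) ^ α = τ ^ (α / 2) := by
    rw [Real.sqrt_eq_rpow, ← Real.rpow_mul hτ.le]; congr 1; ring
  simp only [Real.mul_rpow (Real.sqrt_nonneg τ) (norm_nonneg _), e2, mul_assoc,
    integral_const_mul] at e
  calc _ = ∫ y : Euc N, c * (‖y‖ ^ α * heat τ y) := by rw [integral_const_mul, e]; ring
    _ ≤ _ := by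
      refine integral_mono_of_nonneg (ae_of_all _ fun y => ?_)
        (H.integrable_f_mul_heat hN hs hs1 hτ 0) (hle τ hτ)
      have := heat_nonneg hτ y
      simp only [Pi.zero_apply]
      positivity

/-- The right-hand side of a weak solution cannot dominate a multiple of `|y|^α`, `α > -2s`. -/
lemma not_rpow_le (H : WeakSolution s u f) (hN : 0 < N) (hs : 0 < s) (hs1 : s < 1)
    {α c : ℝ} (hα : -2 * s < α) (hc : 0 < c) : ¬ ∀ᵐ y : Euc N, c * ‖y‖ ^ α ≤ f y := by
  intro hf
  obtain ⟨G, hG, hGF⟩ := H.rpow_mul_le_integral_f_mul_heat hN hs hs1 hc hf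
  set m : ℝ := min 1 (2 ^ (α / 2)) with hm
  have hm0 : 0 < m := lt_min one_pos (by positivity)
  obtain ⟨K, hK⟩ : ∃ K : ℝ, ∀ R > 0,
      ∫ r in Ioo 0 R, r ^ (s - 1) * ∫ y, f y * heat (1 + r) (0 - y) ≤ K :=
    ⟨_, fun R hR => H.integral_rpow_mul_heat_f_le hN hs hs1 one_pos hR 0⟩
  have hlow : ∀ R > 1, G * m * Real.log R ≤ K := by
    intro R hR
    have hI := (H.integral_rpow_mul_heat_f hN hs hs1 one_pos (one_pos.trans hR) 0).1
    have hsub : Ioo 1 R ⊆ Ioo 0 R := Ioo_subset_Ioo_left zero_le_one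
    have hinv : IntegrableOn (fun r : ℝ => r⁻¹) (Ioo 1 R) := by
      refine (ContinuousOn.integrableOn_Icc ?_).mono_set Ioo_subset_Icc_self
      exact continuousOn_id.inv₀ fun r hr => (one_pos.trans_le hr.1).ne'
    have h0 : ∀ r ∈ Ioo (0 : ℝ) R, 0 ≤ r ^ (s - 1) * ∫ y, f y * heat (1 + r) (0 - y) := by
      intro r hr
      have := hr.1
      have := H.integral_f_mul_heat_nonneg (show 0 < 1 + r by positivity) 0
      positivity
    calc G * m * Real.log R = ∫ r in Ioo 1 R, G * m * r⁻¹ := by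
          rw [integral_const_mul, ← integral_Ioc_eq_integral_Ioo,
            ← intervalIntegral.integral_of_le hR.le,
            integral_inv_of_pos one_pos (one_pos.trans hR), div_one]
      _ ≤ ∫ r in Ioo 1 R, r ^ (s - 1) * ∫ y, f y * heat (1 + r) (0 - y) := by
          refine setIntegral_mono_on (hinv.const_mul _) (hI.mono_set hsub) measurableSet_Ioo
            fun r hr => ?_
          have hr1 : 1 < r := hr.1
          have hr0 : 0 < r := one_pos.trans hr1
          have a1 : m * r ^ (α / 2) ≤ (1 + r) ^ (α / 2) := by
            rcases le_total 0 α with h | h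
            · calc m * r ^ (α / 2) ≤ 1 * r ^ (α / 2) := by gcongr; exact min_le_left _ _
                _ ≤ (1 + r) ^ (α / 2) := by
                  rw [one_mul]
                  exact Real.rpow_le_rpow hr0.le (by linarith) (by linarith)
            · calc m * r ^ (α / 2) ≤ 2 ^ (α / 2) * r ^ (α / 2) := by
                    gcongr; exact min_le_right _ _
                _ = (2 * r) ^ (α / 2) := (Real.mul_rpow (by norm_num) hr0.le).symm
                _ ≤ (1 + r) ^ (α / 2) :=
                  Real.rpow_le_rpow_of_nonpos (by linarith) (by linarith) (by linarith)
          calc G * m * r⁻¹ ≤ G * m * r ^ (s - 1 + α / 2) := by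
                rw [← Real.rpow_neg_one]
                gcongr
                · exact hr1.le
                · linarith
            _ = r ^ (s - 1) * (G * (m * r ^ (α / 2))) := by rw [Real.rpow_add hr0]; ring
            _ ≤ r ^ (s - 1) * (G * (1 + r) ^ (α / 2)) := by gcongr
            _ ≤ _ := by gcongr; exact hGF _ (by linarith)
      _ ≤ ∫ r in Ioo 0 R, r ^ (s - 1) * ∫ y, f y * heat (1 + r) (0 - y) := by
          refine setIntegral_mono_set hI ?_ hsub.eventuallyLE
          filter_upwards [ae_restrict_mem measurableSet_Ioo] with r hr using h0 r hr
      _ ≤ K := hK R (one_pos.trans hR)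
  have h1 : Tendsto (fun R => G * m * Real.log R) atTop atTop :=
    Real.tendsto_log_atTop.const_mul_atTop (by positivity)
  obtain ⟨R, hR, hR1⟩ := ((h1.eventually_gt_atTop K).and (eventually_gt_atTop 1)).exists
  exact absurd (hlow R hR1) (not_le.2 hR)

lemma tendsto_integral_u_mul_heatMean (H : WeakSolution s u f) (hN : 0 < N) (hs : 0 < s)
    (hs1 : s < 1) (hu : ∀ c > 0, ¬ ∀ᵐ y, c ≤ u y) {t : ℝ} (ht : 0 < t) (x : Euc N) :
    Tendsto (fun R => ∫ y, u y * heatMean s t R (x - y)) atTop (nhds 0) := by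
  have hB := betaMass_pos hs hs1
  rw [Metric.tendsto_nhds]
  by_contra! hcon
  obtain ⟨ε, hε, hfr⟩ := hcon
  simp only [Real.dist_eq, sub_zero] at hfr
  set A : ℝ := (3 : ℝ) ^ ((N : ℝ) / 2) * Real.exp (1 / 2) with hA
  have hA0 : 0 < A := by positivity
  have hlow : ∀ x' : Euc N, ∀ t' > 0, ε / (A * betaMass s) ≤ ∫ y, u y * heat t' (x' - y) := by
    intro x' t' ht'
    obtain ⟨R, hR, hR1⟩ := (hfr.and_eventually ((eventually_ge_atTop (3 * t)).and
      ((eventually_ge_atTop t').and (eventually_ge_atTop (‖x - x'‖ ^ 2))))).exists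
    have hR0 : 0 < R := by linarith [hR1.1]
    rw [abs_of_nonneg (H.integral_u_mul_heatMean_nonneg ht hR0 x)] at hR
    have h1 := H.integral_u_mul_heatMean_harnack hN hs hs1 ht ht' hR1.1 hR1.2.1 hR1.2.2
    have h2 := H.integral_u_mul_heatMean_le hN hs hs1 ht' (show 0 < 2 * R by positivity) x'
    rw [div_le_iff₀ (by positivity)]
    calc ε ≤ A * ∫ y, u y * heatMean s t' (2 * R) (x' - y) := hR.trans h1
      _ ≤ A * (betaMass s * ∫ y, u y * heat t' (x' - y)) := by gcongr
      _ = _ := by ring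
  set c := ε / (A * betaMass s) with hc
  have hc0 : 0 < c := by positivity
  refine hu c hc0 ?_
  have hu1 : Integrable (fun y => u y * heat 1 y) := by
    simpa [heat_neg] using H.integrable_u_mul_heat hs one_pos 0
  have key := ae_nonneg_of_heat (v := fun y => u y - c) (H.measurable_u.sub_const c) ?_ ?_
  · filter_upwards [key] with y hy
    linarith
  · simp_rw [sub_mul]
    exact hu1.sub ((integrable_heat one_pos).const_mul c)
  · intro x' t' ht'
    have i1 : Integrable (fun y => heat t' (x' - y)) := (integrable_heat ht').comp_sub_left x'
    simp_rw [sub_mul]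
    rw [integral_sub (H.integrable_u_mul_heat hs ht' x') (i1.const_mul c), integral_const_mul,
      integral_sub_left_eq_self (fun y => heat t' y), integral_heat ht', mul_one]
    linarith [hlow x' t' ht']

/-- The time integral of the heat flow of the right-hand side. -/
lemma lintegral_rpow_mul_heat_f (H : WeakSolution s u f) (hN : 0 < N) (hs : 0 < s)
    (hs1 : s < 1) (hu : ∀ c > 0, ¬ ∀ᵐ y, c ≤ u y) {t : ℝ} (ht : 0 < t) (x : Euc N) :
    ∫⁻ r in Ioi (0 : ℝ), ENNReal.ofReal (r ^ (s - 1) * ∫ y, f y * heat (t + r) (x - y))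
      = ENNReal.ofReal ((subConst N (-s))⁻¹ / s * (betaMass s * ∫ y, u y * heat t (x - y))) := by
  have hm : AEMeasurable (fun r : ℝ => ENNReal.ofReal
      (r ^ (s - 1) * ∫ y, f y * heat (t + r) (x - y))) (volume.restrict (Ioi 0)) := by
    have h1 := measurable_heat (N := N)
    have h2 : Measurable (Function.uncurry fun (r : ℝ) (y : Euc N) => f y * heat (t + r) (x - y)) := by
      simp only [Function.uncurry_def]
      exact (H.measurable_f.comp measurable_snd).mul (h1.comp
        (by fun_prop : Measurable (fun p : ℝ × Euc N => (t + p.1, x - p.2))))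
    have h3 := (h2.stronglyMeasurable.integral_prod_right (ν := (volume : Measure (Euc N)))).measurable
    exact (((measurable_id.pow_const (s - 1)).mul h3).ennreal_ofReal).aemeasurable
  have hcov : AECover (volume.restrict (Ioi (0 : ℝ))) atTop (fun R : ℝ => Iio R) :=
    (aecover_Iio tendsto_id).restrict
  refine hcov.lintegral_eq_of_tendsto _ hm ?_
  have hlim := ((tendsto_const_nhds (x := betaMass s * ∫ y, u y * heat t (x - y))).sub
    (H.tendsto_integral_u_mul_heatMean hN hs hs1 hu ht x)).const_mul ((subConst N (-s))⁻¹ / s)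
  rw [sub_zero] at hlim
  refine ((ENNReal.continuous_ofReal.tendsto _).comp hlim).congr' ?_
  filter_upwards [eventually_gt_atTop 0] with R hR
  have h := H.integral_rpow_mul_heat_f hN hs hs1 ht hR x
  rw [Function.comp_apply, ← h.2.2, Measure.restrict_restrict measurableSet_Iio, Iio_inter_Ioi,
    ofReal_integral_eq_lintegral_ofReal h.1]
  filter_upwards [ae_restrict_mem measurableSet_Ioo] with r hr
  have := hr.1
  have := H.integral_f_mul_heat_nonneg (show 0 < t + r by positivity) x
  simp only [Pi.zero_apply]
  positivity

end WeakSolution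

end Vanishing

section Riesz

variable {N : ℕ} {s : ℝ} {u f : Euc N → ℝ}

/-- The Riesz kernel of order `2s`, smoothed by the heat semigroup. -/
lemma lintegral_heat_mul_riesz (hN : 0 < N) (hsN : s < (N : ℝ) / 2)
    {t : ℝ} (ht : 0 < t) (x y : Euc N) :
    ∫⁻ z, ENNReal.ofReal (heat t (x - z)) *
        ENNReal.ofReal (subConst N s * ‖z - y‖ ^ (2 * s - (N : ℝ)))
      = ∫⁻ r in Ioi (0 : ℝ), ENNReal.ofReal (r ^ (s - 1) * heat (t + r) (x - y)) := by
  have : Nontrivial (Euc N) := by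
    apply Module.nontrivial_of_finrank_pos (R := ℝ); simpa using hN
  have hm := measurable_heat (N := N)
  calc _ = ∫⁻ z, ∫⁻ r in Ioi (0 : ℝ), ENNReal.ofReal (heat t (x - z)) *
        ENNReal.ofReal (r ^ (s - 1) * heat r (z - y)) := by
        refine lintegral_congr_ae ?_
        filter_upwards [compl_mem_ae_iff.2 (measure_singleton y)] with z hz
        rw [lintegral_const_mul' _ _ ENNReal.ofReal_ne_top,
          lintegral_rpow_mul_heat hsN (sub_ne_zero.2 hz)]
    _ = ∫⁻ r in Ioi (0 : ℝ), ∫⁻ z, ENNReal.ofReal (heat t (x - z)) *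
        ENNReal.ofReal (r ^ (s - 1) * heat r (z - y)) := by
        refine lintegral_lintegral_swap (Measurable.aemeasurable ?_)
        have h1 : Measurable (fun p : Euc N × ℝ => heat t (x - p.1)) :=
          (continuous_heat t).measurable.comp (by fun_prop)
        have h2 : Measurable (fun p : Euc N × ℝ => heat p.2 (p.1 - y)) :=
          hm.comp (by fun_prop : Measurable (fun p : Euc N × ℝ => (p.2, p.1 - y)))
        simp only [Function.uncurry_def]
        fun_prop
    _ = _ := by
        refine setLIntegral_congr_fun measurableSet_Ioi fun r hr => ?_
        have hr : 0 < r := hr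
        have e : ∀ z, ENNReal.ofReal (heat t (x - z)) * ENNReal.ofReal (r ^ (s - 1) * heat r (z - y))
            = ENNReal.ofReal (r ^ (s - 1)) *
              ENNReal.ofReal (heat t ((x - y) - (z - y)) * heat r (z - y)) := by
          intro z
          rw [ENNReal.ofReal_mul (by positivity), ENNReal.ofReal_mul (heat_nonneg ht _),
            sub_sub_sub_cancel_right, mul_left_comm]
        simp_rw [e]
        rw [lintegral_const_mul' _ _ ENNReal.ofReal_ne_top,
          lintegral_sub_right_eq_self
            (fun w => ENNReal.ofReal (heat t ((x - y) - w) * heat r w)) y,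
          ← ofReal_integral_eq_lintegral_ofReal (integrable_heat_mul_heat ht hr _)
            (ae_of_all _ fun w => mul_nonneg (heat_nonneg ht _) (heat_nonneg hr _)),
          heat_convolution ht hr, ← ENNReal.ofReal_mul (by positivity)]

/-- The constant in the Riesz representation of weak solutions. -/
noncomputable def rieszConst (N : ℕ) (s : ℝ) : ℝ :=
  subConst N s / ((subConst N (-s))⁻¹ / s * betaMass s)

lemma rieszConst_pos (hs : 0 < s) (hs1 : s < 1)
    (hsN : s < (N : ℝ) / 2) : 0 < rieszConst N s := by
  have hK := subConst_pos hsN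
  have hK' := subConst_pos (show -s < (N : ℝ) / 2 by linarith)
  have hB := betaMass_pos hs hs1
  unfold rieszConst
  positivity

namespace WeakSolution

lemma lintegral_heat_mul_potential (H : WeakSolution s u f) (hN : 0 < N) (hs : 0 < s)
    (hs1 : s < 1) (hsN : s < (N : ℝ) / 2) (hu : ∀ c > 0, ¬ ∀ᵐ y, c ≤ u y)
    {t : ℝ} (ht : 0 < t) (x : Euc N) :
    ∫⁻ z, ENNReal.ofReal (heat t (x - z)) * ∫⁻ y, ENNReal.ofReal (f y) *
        ENNReal.ofReal (subConst N s * ‖z - y‖ ^ (2 * s - (N : ℝ)))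
      = ENNReal.ofReal ((subConst N (-s))⁻¹ / s * (betaMass s * ∫ y, u y * heat t (x - y))) := by
  have hm := measurable_heat (N := N)
  have hf := H.measurable_f
  have hht := (continuous_heat (N := N) t).measurable
  rw [← H.lintegral_rpow_mul_heat_f hN hs hs1 hu ht x]
  calc _ = ∫⁻ z, ∫⁻ y, ENNReal.ofReal (heat t (x - z)) * (ENNReal.ofReal (f y) *
        ENNReal.ofReal (subConst N s * ‖z - y‖ ^ (2 * s - (N : ℝ)))) := by
        simp_rw [lintegral_const_mul' _ _ ENNReal.ofReal_ne_top]
    _ = ∫⁻ y, ∫⁻ z, ENNReal.ofReal (heat t (x - z)) * (ENNReal.ofReal (f y) *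
        ENNReal.ofReal (subConst N s * ‖z - y‖ ^ (2 * s - (N : ℝ)))) := by
        refine lintegral_lintegral_swap (Measurable.aemeasurable ?_)
        simp only [Function.uncurry_def]
        fun_prop
    _ = ∫⁻ y, ∫⁻ r in Ioi (0 : ℝ), ENNReal.ofReal (f y) *
          ENNReal.ofReal (r ^ (s - 1) * heat (t + r) (x - y)) := by
        refine lintegral_congr fun y => ?_
        simp_rw [mul_left_comm (ENNReal.ofReal (heat t _))]
        rw [lintegral_const_mul' _ _ ENNReal.ofReal_ne_top,
          lintegral_const_mul' _ _ ENNReal.ofReal_ne_top, lintegral_heat_mul_riesz hN hsN ht]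
    _ = ∫⁻ r in Ioi (0 : ℝ), ∫⁻ y, ENNReal.ofReal (f y) *
          ENNReal.ofReal (r ^ (s - 1) * heat (t + r) (x - y)) := by
        refine lintegral_lintegral_swap (Measurable.aemeasurable ?_)
        have h2 : Measurable (fun p : Euc N × ℝ => heat (t + p.2) (x - p.1)) :=
          hm.comp (by fun_prop : Measurable (fun p : Euc N × ℝ => (t + p.2, x - p.1)))
        simp only [Function.uncurry_def]
        fun_prop
    _ = _ := by
        refine setLIntegral_congr_fun measurableSet_Ioi fun r hr => ?_
        have hr : 0 < r := hr
        have htr : 0 < t + r := by positivity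
        rw [ENNReal.ofReal_mul (by positivity), ofReal_integral_eq_lintegral_ofReal
          (H.integrable_f_mul_heat hN hs hs1 htr x)
          (ae_of_all _ fun y => mul_nonneg (H.f_nonneg y) (heat_nonneg htr _)),
          ← lintegral_const_mul' _ _ ENNReal.ofReal_ne_top]
        refine lintegral_congr fun y => ?_
        rw [ENNReal.ofReal_mul (by positivity), ENNReal.ofReal_mul (H.f_nonneg y), mul_left_comm]

/-- A weak solution not essentially bounded below by a positive constant is the Riesz potential
of its right-hand side. -/
lemma ae_eq_riesz (H : WeakSolution s u f) (hN : 0 < N) (hs : 0 < s)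
    (hs1 : s < 1) (hsN : s < (N : ℝ) / 2) (hu : ∀ c > 0, ¬ ∀ᵐ y, c ≤ u y) :
    ∀ᵐ x, Integrable (fun y => f y / ‖x - y‖ ^ ((N : ℝ) - 2 * s)) ∧
      u x = rieszConst N s * ∫ y, f y / ‖x - y‖ ^ ((N : ℝ) - 2 * s) := by
  have hK := subConst_pos hsN
  have hK' := subConst_pos (show -s < (N : ℝ) / 2 by linarith)
  have hB := betaMass_pos hs hs1
  have hf := H.measurable_f
  obtain ⟨c, hc⟩ : ∃ c, c = (subConst N (-s))⁻¹ / s * betaMass s := ⟨_, rfl⟩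
  have hc0 : 0 < c := by rw [hc]; positivity
  obtain ⟨V, hV⟩ : ∃ V : Euc N → ENNReal, V = fun z => ∫⁻ y, ENNReal.ofReal (f y) *
        ENNReal.ofReal (subConst N s * ‖z - y‖ ^ (2 * s - (N : ℝ))) := ⟨_, rfl⟩
  have hmV : Measurable V := by
    rw [hV]
    refine Measurable.lintegral_prod_right ?_
    simp only [Function.uncurry_def]
    fun_prop
  have hA : ∀ x, ∀ t > 0, ∫⁻ z, ENNReal.ofReal (heat t (x - z)) * V z
      = ENNReal.ofReal (c * ∫ y, u y * heat t (x - y)) := by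
    intro x t ht
    rw [hV, hc, mul_assoc]
    exact H.lintegral_heat_mul_potential hN hs hs1 hsN hu ht x
  have hmh : ∀ t (x : Euc N), Measurable (fun z : Euc N => heat t (x - z)) := fun t x =>
    (continuous_heat t).measurable.comp (measurable_const.sub measurable_id)
  have hVfin : ∀ᵐ z, V z < ⊤ := by
    have h1 := ae_lt_top' ((hmh 1 0).ennreal_ofReal.mul hmV).aemeasurable
      ((hA 0 1 one_pos).trans_ne ENNReal.ofReal_ne_top)
    filter_upwards [h1] with z hz
    exact ENNReal.lt_top_of_mul_ne_top_right hz.ne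
      (ENNReal.ofReal_pos.2 (heat_pos one_pos _)).ne'
  have hmVr : Measurable (fun z => (V z).toReal) := hmV.ennreal_toReal
  have hVr : ∀ x, ∀ t > 0, Integrable (fun z => (V z).toReal * heat t (x - z)) ∧
      ∫ z, (V z).toReal * heat t (x - z) = c * ∫ y, u y * heat t (x - y) := by
    intro x t ht
    have h0 : ∀ z, 0 ≤ (V z).toReal * heat t (x - z) := fun z =>
      mul_nonneg ENNReal.toReal_nonneg (heat_nonneg ht _)
    have hms : AEStronglyMeasurable (fun z => (V z).toReal * heat t (x - z)) volume :=
      (hmVr.mul (hmh t x)).aestronglyMeasurable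
    have e : ∫⁻ z, ENNReal.ofReal ((V z).toReal * heat t (x - z))
        = ENNReal.ofReal (c * ∫ y, u y * heat t (x - y)) := by
      rw [← hA x t ht]
      refine lintegral_congr_ae ?_
      filter_upwards [hVfin] with z hz
      rw [ENNReal.ofReal_mul ENNReal.toReal_nonneg, ENNReal.ofReal_toReal hz.ne, mul_comm]
    refine ⟨⟨hms, ?_⟩, ?_⟩
    · rw [hasFiniteIntegral_iff_ofReal (ae_of_all _ h0), e]
      exact ENNReal.ofReal_lt_top
    · rw [integral_eq_lintegral_of_nonneg_ae (ae_of_all _ h0) hms, e, ENNReal.toReal_ofReal]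
      exact mul_nonneg hc0.le (integral_nonneg fun y =>
        mul_nonneg (H.u_nonneg y) (heat_nonneg ht _))
  have hu1 : ∀ x, ∀ t > 0, Integrable (fun y => c * (u y * heat t (x - y))) := fun x t ht =>
    (H.integrable_u_mul_heat hs ht x).const_mul c
  have hle : ∀ᵐ z, 0 ≤ c * u z - (V z).toReal := by
    refine ae_nonneg_of_heat ((H.measurable_u.const_mul c).sub hmVr) ?_ fun x t ht => ?_
    · have := (hu1 0 1 one_pos).sub (hVr 0 1 one_pos).1
      simp only [zero_sub, heat_neg] at this
      refine this.congr (ae_of_all _ fun y => ?_)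
      simp only [Pi.sub_apply]
      ring
    · simp_rw [sub_mul, mul_assoc]
      rw [integral_sub (hu1 x t ht) (hVr x t ht).1, (hVr x t ht).2, integral_const_mul, sub_self]
  have hge : ∀ᵐ z, 0 ≤ (V z).toReal - c * u z := by
    refine ae_nonneg_of_heat (hmVr.sub (H.measurable_u.const_mul c)) ?_ fun x t ht => ?_
    · have := (hVr 0 1 one_pos).1.sub (hu1 0 1 one_pos)
      simp only [zero_sub, heat_neg] at this
      refine this.congr (ae_of_all _ fun y => ?_)
      simp only [Pi.sub_apply]
      ring
    · simp_rw [sub_mul, mul_assoc]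
      rw [integral_sub (hVr x t ht).1 (hu1 x t ht), (hVr x t ht).2, integral_const_mul, sub_self]
  filter_upwards [hVfin, hle, hge] with x hx h1 h2
  have hpow : ∀ y, f y * (subConst N s * ‖x - y‖ ^ (2 * s - (N : ℝ)))
      = subConst N s * (f y / ‖x - y‖ ^ ((N : ℝ) - 2 * s)) := by
    intro y
    rw [show 2 * s - (N : ℝ) = -((N : ℝ) - 2 * s) by ring, Real.rpow_neg (norm_nonneg _)]
    ring
  have h0 : ∀ y, 0 ≤ f y / ‖x - y‖ ^ ((N : ℝ) - 2 * s) := fun y =>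
    div_nonneg (H.f_nonneg y) (by positivity)
  have hms : AEStronglyMeasurable (fun y => f y / ‖x - y‖ ^ ((N : ℝ) - 2 * s)) volume :=
    Measurable.aestronglyMeasurable (by fun_prop)
  have hVx : V x = ENNReal.ofReal (subConst N s) *
      ∫⁻ y, ENNReal.ofReal (f y / ‖x - y‖ ^ ((N : ℝ) - 2 * s)) := by
    rw [hV, ← lintegral_const_mul' _ _ ENNReal.ofReal_ne_top]
    refine lintegral_congr fun y => ?_
    rw [← ENNReal.ofReal_mul (H.f_nonneg y), hpow, ENNReal.ofReal_mul hK.le]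
  have hint : Integrable (fun y => f y / ‖x - y‖ ^ ((N : ℝ) - 2 * s)) := by
    refine ⟨hms, ?_⟩
    rw [hasFiniteIntegral_iff_ofReal (ae_of_all _ h0)]
    rw [hVx] at hx
    exact ENNReal.lt_top_of_mul_ne_top_right hx.ne (ENNReal.ofReal_pos.2 hK).ne'
  refine ⟨hint, ?_⟩
  have e : (V x).toReal = subConst N s * ∫ y, f y / ‖x - y‖ ^ ((N : ℝ) - 2 * s) := by
    rw [hVx, ENNReal.toReal_mul, ENNReal.toReal_ofReal hK.le,
      integral_eq_lintegral_of_nonneg_ae (ae_of_all _ h0) hms]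
  have e2 : c * u x = subConst N s * ∫ y, f y / ‖x - y‖ ^ ((N : ℝ) - 2 * s) := by
    rw [← e]; linarith
  unfold rieszConst
  rw [← hc, div_mul_eq_mul_div, eq_div_iff hc0.ne', ← e2, mul_comm]

end WeakSolution

end Riesz

end FractionalLaplacian

/-- **Integral representation of distributional solutions** (Lemma 2.1).
For `N ≥ 1`, `0 < s < 1` with `N > 2s`, `α > -2s` and `p > 1`, there is a constant
`c = c(N,s) > 0` such that every nonnegative locally bounded `u ∈ L_{2s}` solving
`(-Δ)^s u = |x|^α u^p` in the distributional sense satisfies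
`u(x) = c ∫ |y|^α u(y)^p |x-y|^{-(N-2s)} dy` for a.e. `x`; in particular the integral is
finite for a.e. `x`. -/
theorem distributional_solution_integral_representation
    (N : ℕ) (hN : 0 < N) (s : ℝ) (hs0 : 0 < s) (hs1 : s < 1) (hNs : 2 * s < (N : ℝ)) :
    ∃ c : ℝ, 0 < c ∧
      ∀ (α p : ℝ), -2 * s < α → 1 < p →
        ∀ u : EuclideanSpace ℝ (Fin N) → ℝ,
          Measurable u →
          (∀ x, 0 ≤ u x) →
          (∀ R : ℝ, ∃ C : ℝ, ∀ x : EuclideanSpace ℝ (Fin N), ‖x‖ ≤ R → |u x| ≤ C) →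
          Integrable (fun y : EuclideanSpace ℝ (Fin N) =>
            |u y| / (1 + ‖y‖ ^ ((N : ℝ) + 2 * s))) →
          LocallyIntegrable (fun x : EuclideanSpace ℝ (Fin N) => ‖x‖ ^ α * u x ^ p) →
          (∀ φ : SchwartzMap (EuclideanSpace ℝ (Fin N)) ℝ,
            ∫ x : EuclideanSpace ℝ (Fin N), u x *
                ((1 / 2) * ∫ z : EuclideanSpace ℝ (Fin N),
                  (2 * φ x - φ (x + z) - φ (x - z)) / ‖z‖ ^ ((N : ℝ) + 2 * s)) =
              ∫ x : EuclideanSpace ℝ (Fin N), ‖x‖ ^ α * u x ^ p * φ x) →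
          ∀ᵐ x : EuclideanSpace ℝ (Fin N),
            Integrable (fun y : EuclideanSpace ℝ (Fin N) =>
              ‖y‖ ^ α * u y ^ p / ‖x - y‖ ^ ((N : ℝ) - 2 * s)) ∧
            u x = c * ∫ y : EuclideanSpace ℝ (Fin N),
              ‖y‖ ^ α * u y ^ p / ‖x - y‖ ^ ((N : ℝ) - 2 * s) := by

  have hsN : s < (N : ℝ) / 2 := by linarith
  refine ⟨FractionalLaplacian.rieszConst N s,
    FractionalLaplacian.rieszConst_pos hs0 hs1 hsN, fun α p hα hp u hu hu0 _ hi hf heq => ?_⟩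
  have H : FractionalLaplacian.WeakSolution s u (fun x => ‖x‖ ^ α * u x ^ p) :=
    { measurable_u := hu
      measurable_f := by fun_prop
      u_nonneg := hu0
      f_nonneg := fun x => mul_nonneg (by positivity) (Real.rpow_nonneg (hu0 x) p)
      integrable_u := by
        refine hi.congr (ae_of_all _ fun y => ?_)
        simp only [FractionalLaplacian.wt, abs_of_nonneg (hu0 y), mul_one_div]
      locallyIntegrable_f := hf
      eq := heq }
  refine H.ae_eq_riesz hN hs0 hs1 hsN fun c hc hcu =>
    H.not_rpow_le hN hs0 hs1 hα (Real.rpow_pos_of_pos hc p) ?_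
  filter_upwards [hcu] with y hy
  rw [mul_comm]
  gcongr
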